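/- arXiv:1211.7195 — 3 statements merged into one kernel-verified Lean document; each statement's English description precedes it below -/
import Mathlib

section
/- For every u₀ ∈ 𝓗² the nonlinear Landau–Zener system with datum u₀ has a unique global solution u ∈ C¹(ℝ;𝓗²), and this solution satisfies the conservation law ‖u₁(s)‖² + ‖u₂(s)‖² = ‖u₁(0)‖² + ‖u₂(0)‖² for all s ∈ ℝ. -/
open ContinuousLinearMap Complex Filter Topology
open scoped InnerProductSpace

noncomputable section

variable {H : Type*} [NormedAddCommGroup H] [InnerProductSpace ℂ H] [CompleteSpace H]

/-- Functional calculus `χ(A)` of a selfadjoint operator `A` for a complex-valued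
function `χ : ℝ → ℂ` (defined via the real continuous functional calculus applied to
the real and imaginary parts of `χ`). -/
def fc (χ : ℝ → ℂ) (A : H →L[ℂ] H) : H →L[ℂ] H :=
  cfc (fun x : ℝ => (χ x).re) A + Complex.I • cfc (fun x : ℝ => (χ x).im) A

/-- The commutation assumption: for every continuous `χ : ℝ → ℂ`,
`χ(GG*)G = Gχ(G*G)` and `χ(G*G)G* = G*χ(GG*)`. -/
def CommHyp (G : H →L[ℂ] H) : Prop :=
  ∀ χ : ℝ → ℂ, Continuous χ →
    (fc χ (G * ContinuousLinearMap.adjoint G)) ∘L G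
        = G ∘L (fc χ (ContinuousLinearMap.adjoint G * G)) ∧
    (fc χ (ContinuousLinearMap.adjoint G * G)) ∘L ContinuousLinearMap.adjoint G
        = ContinuousLinearMap.adjoint G ∘L (fc χ (G * ContinuousLinearMap.adjoint G))

/-- The equivalence between `𝓗²` (with its Hilbert space structure) and `𝓗 × 𝓗`. -/
def eqv : WithLp 2 (H × H) ≃L[ℂ] H × H := WithLp.prodContinuousLinearEquiv 2 ℂ H H

/-- The operator `V(s)(w₁,w₂) = (s·w₁ + Gw₂, G*w₁ − s·w₂)` on `𝓗²`. -/
def Vop (G : H →L[ℂ] H) (s : ℝ) : WithLp 2 (H × H) →L[ℂ] WithLp 2 (H × H) :=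
  (eqv (H := H)).symm.toContinuousLinearMap ∘L
    ((((s : ℂ) • ContinuousLinearMap.fst ℂ H H + G ∘L ContinuousLinearMap.snd ℂ H H)).prod
      ((ContinuousLinearMap.adjoint G) ∘L ContinuousLinearMap.fst ℂ H H
        - (s : ℂ) • ContinuousLinearMap.snd ℂ H H)) ∘L
    (eqv (H := H)).toContinuousLinearMap

/-- `F₁(u) = f₁(‖u₁‖², ‖u₂‖²)`. -/
def F1 (f₁ : ℝ × ℝ → ℝ) (u : WithLp 2 (H × H)) : ℝ := f₁ (‖u.fst‖ ^ 2, ‖u.snd‖ ^ 2)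

/-- `F₂(u) = f₂(‖u₁‖², ‖u₂‖²)`. -/
def F2 (f₂ : ℝ × ℝ → ℝ) (u : WithLp 2 (H × H)) : ℝ := f₂ (‖u.fst‖ ^ 2, ‖u.snd‖ ^ 2)

/-- The nonlinear term `F(u)u = (F₁(u)u₁, F₂(u)u₂)`. -/
def nlt (f₁ f₂ : ℝ × ℝ → ℝ) (u : WithLp 2 (H × H)) : WithLp 2 (H × H) :=
  (WithLp.equiv 2 (H × H)).symm ((F1 f₁ u) • u.fst, (F2 f₂ u) • u.snd)

/-- `u` is a (global, `C¹`) solution of `−i u′(s) = V(s)u(s) + δ F(u(s))u(s)`: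
equivalently, `u′(s) = i (V(s)u(s) + δ F(u(s))u(s))` for all `s`. -/
def IsLZSol (G : H →L[ℂ] H) (δ : ℝ) (f₁ f₂ : ℝ × ℝ → ℝ) (u : ℝ → WithLp 2 (H × H)) : Prop :=
  ∀ s : ℝ, HasDerivAt u (Complex.I • (Vop G s (u s) + δ • nlt f₁ f₂ (u s))) s

/-- `f ∈ C²(ℝ²;ℝ)` with bounded second derivative. -/
def C2Bdd (f : ℝ × ℝ → ℝ) : Prop :=
  ContDiff ℝ 2 f ∧ ∃ C : ℝ, ∀ p : ℝ × ℝ, ‖iteratedFDeriv ℝ 2 f p‖ ≤ C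

/-- `θ ∈ C_c^∞(ℝ;ℝ)`, `0 ≤ θ ≤ 1`, `θ = 1` on `(−1/2,1/2)` and `θ = 0` outside `[−1,1]`. -/
def IsCutoff (θ : ℝ → ℝ) : Prop :=
  ContDiff ℝ (⊤ : ℕ∞) θ ∧ HasCompactSupport θ ∧ (∀ x, 0 ≤ θ x ∧ θ x ≤ 1) ∧
    (∀ x, |x| < 1/2 → θ x = 1) ∧ (∀ x, 1 < |x| → θ x = 0)

/-- The cutoff operator `Θ_R = diag(θ(GG*/R²), θ(G*G/R²))`. -/
def Theta (G : H →L[ℂ] H) (θ : ℝ → ℝ) (R : ℝ) :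
    WithLp 2 (H × H) →L[ℂ] WithLp 2 (H × H) :=
  (eqv (H := H)).symm.toContinuousLinearMap ∘L
    ((cfc (fun x : ℝ => θ (x / R ^ 2)) (G * ContinuousLinearMap.adjoint G)).prodMap
      (cfc (fun x : ℝ => θ (x / R ^ 2)) (ContinuousLinearMap.adjoint G * G))) ∘L
    (eqv (H := H)).toContinuousLinearMap

/-- The phase `φ(s,λ) = s²/2 + (λ/2)·log|s|`. -/
def phase (s lam : ℝ) : ℝ := s ^ 2 / 2 + lam / 2 * Real.log |s|

/-- The unitary operator `e^{iφ(s,GG*)}` on `𝓗`. -/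
def ePhaseP (G : H →L[ℂ] H) (s : ℝ) : H →L[ℂ] H :=
  fc (fun lam => Complex.exp (Complex.I * (phase s lam))) (G * ContinuousLinearMap.adjoint G)

/-- The unitary operator `e^{−iφ(s,G*G)}` on `𝓗`. -/
def ePhaseM (G : H →L[ℂ] H) (s : ℝ) : H →L[ℂ] H :=
  fc (fun lam => Complex.exp (-(Complex.I * (phase s lam))))
    (ContinuousLinearMap.adjoint G * G)

/-- The model asymptotic first component `e^{iδF₁(ω)s + iϕ}·e^{iφ(s,GG*)}ω₁`. -/
def asym1 (G : H →L[ℂ] H) (δ : ℝ) (f₁ : ℝ × ℝ → ℝ) (ω : WithLp 2 (H × H)) (ϕ : ℝ)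
    (s : ℝ) : H :=
  Complex.exp (Complex.I * (δ * F1 f₁ ω * s + ϕ)) • (ePhaseP G s ω.fst)

/-- The model asymptotic second component `e^{iδF₂(ω)s − iϕ}·e^{−iφ(s,G*G)}ω₂`. -/
def asym2 (G : H →L[ℂ] H) (δ : ℝ) (f₂ : ℝ × ℝ → ℝ) (ω : WithLp 2 (H × H)) (ϕ : ℝ)
    (s : ℝ) : H :=
  Complex.exp (Complex.I * (δ * F2 f₂ ω * s - ϕ)) • (ePhaseM G s ω.snd)

/-- `α` is the incoming scattering state (at `s → −∞`) of `u`, with phase shift `ϕ`. -/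
def Incoming (G : H →L[ℂ] H) (δ : ℝ) (f₁ f₂ : ℝ × ℝ → ℝ) (α : WithLp 2 (H × H)) (ϕ : ℝ)
    (u : ℝ → WithLp 2 (H × H)) : Prop :=
  Tendsto (fun s => ‖(u s).fst - asym1 G δ f₁ α ϕ s‖ + ‖(u s).snd - asym2 G δ f₂ α ϕ s‖)
    atBot (𝓝 0)

/-- `ω` is the outgoing scattering state (at `s → +∞`) of `u`, with phase shift `ϕ`. -/
def Outgoing (G : H →L[ℂ] H) (δ : ℝ) (f₁ f₂ : ℝ × ℝ → ℝ) (ω : WithLp 2 (H × H)) (ϕ : ℝ)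
    (u : ℝ → WithLp 2 (H × H)) : Prop :=
  Tendsto (fun s => ‖(u s).fst - asym1 G δ f₁ ω ϕ s‖ + ‖(u s).snd - asym2 G δ f₂ ω ϕ s‖)
    atTop (𝓝 0)

/-- `M(u) = (δ/2)(F₁(u) + F₂(u))`. -/
def Mscal (δ : ℝ) (f₁ f₂ : ℝ × ℝ → ℝ) (u : WithLp 2 (H × H)) : ℝ :=
  δ / 2 * (F1 f₁ u + F2 f₂ u)

/-- `m(u) = (δ/2)(F₁(u) − F₂(u))`. -/
def mscal (δ : ℝ) (f₁ f₂ : ℝ × ℝ → ℝ) (u : WithLp 2 (H × H)) : ℝ :=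
  δ / 2 * (F1 f₁ u - F2 f₂ u)

/-- The gauge transform `v(s) = e^{−i∫₀ˢ M(u(τ))dτ}·u(s)`. -/
def gaugeT (δ : ℝ) (f₁ f₂ : ℝ × ℝ → ℝ) (u : ℝ → WithLp 2 (H × H)) :
    ℝ → WithLp 2 (H × H) :=
  fun s => Complex.exp (-(Complex.I * (∫ τ in (0:ℝ)..s, Mscal δ f₁ f₂ (u τ)))) • u s

/-- `σ(s) = s + m(u(s))`. -/
def sigma (δ : ℝ) (f₁ f₂ : ℝ × ℝ → ℝ) (u : ℝ → WithLp 2 (H × H)) (s : ℝ) : ℝ :=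
  s + mscal δ f₁ f₂ (u s)

/-- The operator `Λ_t = diag((t² + GG*)^{1/2}, (t² + G*G)^{1/2})` on `𝓗²`. -/
def LamOp (G : H →L[ℂ] H) (t : ℝ) : WithLp 2 (H × H) →L[ℂ] WithLp 2 (H × H) :=
  (eqv (H := H)).symm.toContinuousLinearMap ∘L
    ((cfc (fun x : ℝ => Real.sqrt (t ^ 2 + x)) (G * ContinuousLinearMap.adjoint G)).prodMap
      (cfc (fun x : ℝ => Real.sqrt (t ^ 2 + x)) (ContinuousLinearMap.adjoint G * G))) ∘L
    (eqv (H := H)).toContinuousLinearMap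

/-- The operator `Λ_t⁻¹ = diag((t² + GG*)^{-1/2}, (t² + G*G)^{-1/2})` on `𝓗²`. -/
def LamInv (G : H →L[ℂ] H) (t : ℝ) : WithLp 2 (H × H) →L[ℂ] WithLp 2 (H × H) :=
  (eqv (H := H)).symm.toContinuousLinearMap ∘L
    ((cfc (fun x : ℝ => (Real.sqrt (t ^ 2 + x))⁻¹)
        (G * ContinuousLinearMap.adjoint G)).prodMap
      (cfc (fun x : ℝ => (Real.sqrt (t ^ 2 + x))⁻¹)
        (ContinuousLinearMap.adjoint G * G))) ∘L
    (eqv (H := H)).toContinuousLinearMap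

/-- The projection `Π_t^+ = (1/2)(Id + Λ_t⁻¹V(t))`. -/
def PiP (G : H →L[ℂ] H) (t : ℝ) : WithLp 2 (H × H) →L[ℂ] WithLp 2 (H × H) :=
  (2 : ℂ)⁻¹ • (1 + LamInv G t ∘L Vop G t)

/-- The projection `Π_t^- = (1/2)(Id − Λ_t⁻¹V(t))`. -/
def PiM (G : H →L[ℂ] H) (t : ℝ) : WithLp 2 (H × H) →L[ℂ] WithLp 2 (H × H) :=
  (2 : ℂ)⁻¹ • (1 - LamInv G t ∘L Vop G t)

/-- `m̃(x,y) = (δ/2)(f₁(x,y) − f₂(x,y))`. -/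
def mtilde (δ : ℝ) (f₁ f₂ : ℝ × ℝ → ℝ) : ℝ × ℝ → ℝ := fun p => δ / 2 * (f₁ p - f₂ p)

/-- `m̲(s) = (∂₁m̃ − ∂₂m̃)(‖v₁(s)‖², ‖v₂(s)‖²)`. -/
def mbar (δ : ℝ) (f₁ f₂ : ℝ × ℝ → ℝ) (v : ℝ → WithLp 2 (H × H)) (s : ℝ) : ℝ :=
  fderiv ℝ (mtilde δ f₁ f₂) (‖(v s).fst‖ ^ 2, ‖(v s).snd‖ ^ 2) (1, 0) -
    fderiv ℝ (mtilde δ f₁ f₂) (‖(v s).fst‖ ^ 2, ‖(v s).snd‖ ^ 2) (0, 1)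


/-- The operator `A(a,b,c,d)(w₁,w₂) = (a(GG*)w₁ + b(GG*)Gw₂, c(G*G)G*w₁ + d(G*G)w₂)`. -/
def Aop (G : H →L[ℂ] H) (a b c d : ℝ → ℂ) :
    WithLp 2 (H × H) →L[ℂ] WithLp 2 (H × H) :=
  (eqv (H := H)).symm.toContinuousLinearMap ∘L
    (((fc a (G * ContinuousLinearMap.adjoint G)) ∘L ContinuousLinearMap.fst ℂ H H
        + (fc b (G * ContinuousLinearMap.adjoint G)) ∘L G ∘L ContinuousLinearMap.snd ℂ H H).prod
      ((fc c (ContinuousLinearMap.adjoint G * G)) ∘L (ContinuousLinearMap.adjoint G)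
          ∘L ContinuousLinearMap.fst ℂ H H
        + (fc d (ContinuousLinearMap.adjoint G * G)) ∘L ContinuousLinearMap.snd ℂ H H)) ∘L
    (eqv (H := H)).toContinuousLinearMap

/-- The operator `𝒦(w₁,w₂) = (−Gw₂, G*w₁)` on `𝓗²`. -/
def Kcal (G : H →L[ℂ] H) : WithLp 2 (H × H) →L[ℂ] WithLp 2 (H × H) :=
  (eqv (H := H)).symm.toContinuousLinearMap ∘L
    ((-(G ∘L ContinuousLinearMap.snd ℂ H H)).prod
      ((ContinuousLinearMap.adjoint G) ∘L ContinuousLinearMap.fst ℂ H H)) ∘L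
    (eqv (H := H)).toContinuousLinearMap

section GlobalExistence

open Set Metric
open scoped NNReal

/-- A time-dependent vector field which, on every bounded time interval, is bounded and uniformly
Lipschitz in space admits global integral curves. -/
theorem exists_forall_hasDerivAt_of_lipschitzWith_of_bounded {E : Type*} [NormedAddCommGroup E]
    [NormedSpace ℝ E] [CompleteSpace E] {v : ℝ → E → E}
    (hlip : ∀ T : ℝ, ∃ K : ℝ≥0, ∀ t ∈ Icc (-T) T, LipschitzWith K (v t))
    (hcont : ∀ x, Continuous fun t => v t x)
    (hbdd : ∀ T : ℝ, ∃ L : ℝ≥0, ∀ t ∈ Icc (-T) T, ∀ x, ‖v t x‖ ≤ L) (x₀ : E) :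
    ∃ u : ℝ → E, u 0 = x₀ ∧ ∀ t, HasDerivAt u (v t (u t)) t := by
  have hloc : ∀ n : ℕ, ∃ α : ℝ → E, α 0 = x₀ ∧
      ∀ t ∈ Ioo (-((n : ℝ) + 1)) (n + 1), HasDerivAt α (v t (α t)) t := by
    intro n
    obtain ⟨K, hK⟩ := hlip (n + 1)
    obtain ⟨L, hL⟩ := hbdd (n + 1)
    have h0 : (0 : ℝ) ∈ Icc (-((n : ℝ) + 1)) (n + 1) := by constructor <;> linarith
    have hpl : IsPicardLindelof v (⟨0, h0⟩ : Icc (-((n : ℝ) + 1)) (n + 1)) x₀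
        (L * (n + 1)) 0 L K :=
      { lipschitzOnWith := fun t ht => (hK t ht).lipschitzOnWith
        continuousOn := fun x _ => (hcont x).continuousOn
        norm_le := fun t ht x _ => hL t ht x
        mul_max_le := by simp }
    obtain ⟨α, hα0, hα⟩ := hpl.exists_eq_forall_mem_Icc_hasDerivWithinAt₀
    exact ⟨α, hα0, fun t ht =>
      (hα t (Ioo_subset_Icc_self ht)).hasDerivAt (Icc_mem_nhds ht.1 ht.2)⟩
  choose α hα0 hα using hloc
  have hagree : ∀ m n : ℕ, m ≤ n → EqOn (α m) (α n) (Ioo (-((m : ℝ) + 1)) (m + 1)) := by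
    intro m n hmn
    have hmn' : (m : ℝ) ≤ n := by exact_mod_cast hmn
    obtain ⟨K, hK⟩ := hlip (m + 1)
    refine ODE_solution_unique_of_mem_Ioo (v := v) (s := fun _ => univ) (t₀ := 0) (K := K)
      (fun t ht => (hK t (Ioo_subset_Icc_self ht)).lipschitzOnWith)
      (by constructor <;> linarith [(Nat.cast_nonneg m : (0 : ℝ) ≤ m)])
      (fun t ht => ⟨hα m t ht, mem_univ _⟩) (fun t ht => ⟨hα n t ?_, mem_univ _⟩)
      (by rw [hα0, hα0])
    exact ⟨by linarith [ht.1], by linarith [ht.2]⟩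
  have hmem : ∀ t : ℝ, t ∈ Ioo (-((⌈|t|⌉₊ : ℝ) + 1)) (⌈|t|⌉₊ + 1) := fun t =>
    abs_lt.1 ((Nat.le_ceil |t|).trans_lt (lt_add_one _))
  have heq : ∀ n : ℕ, EqOn (fun t => α ⌈|t|⌉₊ t) (α n) (Ioo (-((n : ℝ) + 1)) (n + 1)) := by
    intro n t ht
    rcases le_total ⌈|t|⌉₊ n with h | h
    · exact hagree _ _ h (hmem t)
    · exact (hagree _ _ h ht).symm
  refine ⟨fun t => α ⌈|t|⌉₊ t, hα0 _, fun t => ?_⟩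
  exact (hα _ t (hmem t)).congr_of_eventuallyEq
    ((heq _).eventuallyEq_of_mem (isOpen_Ioo.mem_nhds (hmem t)))

/-- The radial retraction onto the closed ball of radius `R` is Lipschitz. -/
theorem lipschitzWith_radial_retraction {F : Type*} [NormedAddCommGroup F] [NormedSpace ℝ F]
    {R : ℝ} (hR : 0 < R) : LipschitzWith 2 fun x : F => (R / max R ‖x‖) • x := by
  refine LipschitzWith.of_dist_le_mul fun x y => ?_
  have hx : 0 < max R ‖x‖ := lt_max_of_lt_left hR
  have hy : 0 < max R ‖y‖ := lt_max_of_lt_left hR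
  have hsplit : (R / max R ‖x‖) • x - (R / max R ‖y‖) • y
      = (R / max R ‖x‖) • (x - y) + (R / max R ‖x‖ - R / max R ‖y‖) • y := by
    rw [smul_sub, sub_smul]; abel
  have hmax : |max R ‖y‖ - max R ‖x‖| ≤ ‖x - y‖ := by
    have h1 := abs_max_sub_max_le_max R ‖y‖ R ‖x‖
    rw [sub_self, abs_zero, max_eq_right (abs_nonneg (‖y‖ - ‖x‖))] at h1
    exact h1.trans ((abs_norm_sub_norm_le y x).trans_eq (norm_sub_rev y x))
  have h1 : R / max R ‖x‖ ≤ 1 := (div_le_one hx).2 (le_max_left _ _)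
  have h2 : |R / max R ‖x‖ - R / max R ‖y‖| * ‖y‖ ≤ ‖x - y‖ := by
    have : R / max R ‖x‖ - R / max R ‖y‖
        = R / max R ‖x‖ * ((max R ‖y‖ - max R ‖x‖) / max R ‖y‖) := by
      field_simp
    rw [this, abs_mul, abs_of_pos (div_pos hR hx), abs_div, abs_of_pos hy]
    calc _ = R / max R ‖x‖ * (|max R ‖y‖ - max R ‖x‖| * (‖y‖ / max R ‖y‖)) := by ring
      _ ≤ 1 * (‖x - y‖ * 1) := by
        gcongr
        exact (div_le_one hy).2 (le_max_right _ _)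
      _ = ‖x - y‖ := by ring
  rw [dist_eq_norm, dist_eq_norm, hsplit]
  calc _ ≤ ‖(R / max R ‖x‖) • (x - y)‖ + ‖(R / max R ‖x‖ - R / max R ‖y‖) • y‖ := norm_add_le _ _
    _ ≤ 1 * ‖x - y‖ + ‖x - y‖ := by
      rw [norm_smul, norm_smul, Real.norm_of_nonneg (div_pos hR hx).le, Real.norm_eq_abs]
      gcongr
    _ = _ := by push_cast; ring

variable {𝕜 E : Type*} [RCLike 𝕜] [NormedAddCommGroup E] [InnerProductSpace 𝕜 E] [NormedSpace ℝ E]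

/-- The norm is constant along the integral curves of a vector field tangent to spheres. -/
theorem norm_eq_of_hasDerivAt_of_inner_add_inner_eq_zero {u u' : ℝ → E}
    (hu : ∀ t, HasDerivAt u (u' t) t)
    (h : ∀ t, inner 𝕜 (u t) (u' t) + inner 𝕜 (u' t) (u t) = 0) (s t : ℝ) : ‖u s‖ = ‖u t‖ := by
  have hd : ∀ r, HasDerivAt (fun r => inner 𝕜 (u r) (u r)) 0 r := fun r => by
    simpa only [h r] using (hu r).inner 𝕜 (hu r)
  have hc := is_const_of_deriv_eq_zero (fun r => (hd r).differentiableAt)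
    (fun r => (hd r).deriv) s t
  have hc' : (‖u s‖ : 𝕜) ^ 2 = (‖u t‖ : 𝕜) ^ 2 := by
    simpa only [inner_self_eq_norm_sq_to_K] using hc
  have hr : ‖u s‖ ^ 2 = ‖u t‖ ^ 2 := by exact_mod_cast hc'
  exact (pow_left_inj₀ (norm_nonneg _) (norm_nonneg _) two_ne_zero).1 hr

/-- A time-dependent vector field tangent to spheres which is Lipschitz on bounded sets, uniformly
on bounded time intervals, admits global integral curves. -/
theorem exists_forall_hasDerivAt_of_inner_add_inner_eq_zero [IsScalarTower ℝ 𝕜 E] [CompleteSpace E]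
    {v : ℝ → E → E}
    (hlip : ∀ T R : ℝ, ∃ K : ℝ≥0, ∀ t ∈ Icc (-T) T, LipschitzOnWith K (v t) (closedBall 0 R))
    (hcont : ∀ x, Continuous fun t => v t x)
    (h : ∀ t x, inner 𝕜 x (v t x) + inner 𝕜 (v t x) x = 0) (x₀ : E) :
    ∃ u : ℝ → E, u 0 = x₀ ∧ ∀ t, HasDerivAt u (v t (u t)) t := by
  set R : ℝ := ‖x₀‖ + 1
  have hR : 0 < R := by positivity
  set P : E → E := fun x => (R / max R ‖x‖) • x with hPdef
  have hPmem : ∀ x, P x ∈ closedBall (0 : E) R := fun x => by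
    have hx : 0 < max R ‖x‖ := lt_max_of_lt_left hR
    rw [mem_closedBall_zero_iff, hPdef, norm_smul, Real.norm_of_nonneg (div_pos hR hx).le,
      div_mul_eq_mul_div, div_le_iff₀ hx]
    gcongr
    exact le_max_right _ _
  have hPlip : LipschitzWith 2 P := lipschitzWith_radial_retraction hR
  have hPeq : ∀ x, ‖x‖ ≤ R → P x = x := fun x hx => by
    simp [hPdef, max_eq_left hx, div_self hR.ne']
  have htan : ∀ t x, inner 𝕜 x (v t (P x)) + inner 𝕜 (v t (P x)) x = 0 := fun t x => by
    have hc : R / max R ‖x‖ ≠ 0 := (div_pos hR (lt_max_of_lt_left hR)).ne'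
    have hP : P x = ((R / max R ‖x‖ : ℝ) : 𝕜) • x := RCLike.real_smul_eq_coe_smul (K := 𝕜) _ _
    have h1 : inner 𝕜 (((R / max R ‖x‖ : ℝ) : 𝕜) • x) (v t (P x)) +
        inner 𝕜 (v t (P x)) (((R / max R ‖x‖ : ℝ) : 𝕜) • x) = 0 := by
      rw [← hP]
      exact h t (P x)
    rw [inner_smul_left, RCLike.conj_ofReal, inner_smul_right, ← mul_add] at h1
    exact (mul_eq_zero.1 h1).resolve_left (by exact_mod_cast hc)
  obtain ⟨u, hu0, hu⟩ := exists_forall_hasDerivAt_of_lipschitzWith_of_bounded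
    (v := fun t x => v t (P x))
    (fun T => by
      obtain ⟨K, hK⟩ := hlip T R
      refine ⟨K * 2, fun t ht => ?_⟩
      have := (hK t ht).comp (hPlip.lipschitzOnWith (s := univ)) (fun x _ => hPmem x)
      exact lipschitzOnWith_univ.1 this)
    (fun x => hcont (P x))
    (fun T => by
      obtain ⟨K, hK⟩ := hlip T R
      obtain ⟨C, hC⟩ := (isCompact_Icc (a := -T) (b := T)).exists_bound_of_continuousOn
        (hcont 0).continuousOn
      refine ⟨(C + K * R).toNNReal, fun t ht x => le_trans ?_ (Real.le_coe_toNNReal _)⟩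
      have h0 : (0 : E) ∈ closedBall (0 : E) R := mem_closedBall_self hR.le
      have h1 := (hK t ht).dist_le_mul _ (hPmem x) _ h0
      have h2 : dist (P x) 0 ≤ R := hPmem x
      calc ‖v t (P x)‖ ≤ ‖v t 0‖ + ‖v t (P x) - v t 0‖ := norm_le_insert' _ _
        _ ≤ C + K * R := by
          rw [← dist_eq_norm]
          gcongr
          · exact hC t ht
          · exact h1.trans (by gcongr))
    x₀
  refine ⟨u, hu0, fun t => ?_⟩
  have hnorm : ‖u t‖ = ‖x₀‖ := by
    rw [← hu0]
    exact norm_eq_of_hasDerivAt_of_inner_add_inner_eq_zero (𝕜 := 𝕜) hu (fun r => htan r (u r)) t 0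
  simpa only [hPeq (u t) (by rw [hnorm]; exact (lt_add_one _).le)] using hu t

/-- Uniqueness of the global integral curves of a time-dependent vector field tangent to spheres
which is Lipschitz on bounded sets, uniformly on bounded time intervals. -/
theorem eq_of_forall_hasDerivAt_of_inner_add_inner_eq_zero {v : ℝ → E → E}
    (hlip : ∀ T R : ℝ, ∃ K : ℝ≥0, ∀ t ∈ Icc (-T) T, LipschitzOnWith K (v t) (closedBall 0 R))
    (h : ∀ t x, inner 𝕜 x (v t x) + inner 𝕜 (v t x) x = 0) {u w : ℝ → E}
    (hu : ∀ t, HasDerivAt u (v t (u t)) t) (hw : ∀ t, HasDerivAt w (v t (w t)) t)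
    (h0 : u 0 = w 0) : u = w := by
  funext t
  have hun : ∀ s, u s ∈ closedBall (0 : E) ‖u 0‖ := fun s => mem_closedBall_zero_iff.2
    (norm_eq_of_hasDerivAt_of_inner_add_inner_eq_zero (𝕜 := 𝕜) hu (fun r => h r (u r)) s 0).le
  have hwn : ∀ s, w s ∈ closedBall (0 : E) ‖u 0‖ := fun s => mem_closedBall_zero_iff.2 <| by
    rw [h0]
    exact (norm_eq_of_hasDerivAt_of_inner_add_inner_eq_zero (𝕜 := 𝕜) hw
      (fun r => h r (w r)) s 0).le
  obtain ⟨K, hK⟩ := hlip (|t| + 1) ‖u 0‖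
  refine ODE_solution_unique_of_mem_Ioo (v := v) (s := fun _ => closedBall 0 ‖u 0‖) (t₀ := 0)
    (a := -(|t| + 1)) (b := |t| + 1) (fun s hs => hK s (Ioo_subset_Icc_self hs))
    (by constructor <;> linarith [abs_nonneg t])
    (fun s _ => ⟨hu s, hun s⟩) (fun s _ => ⟨hw s, hwn s⟩) h0 (abs_lt.1 (lt_add_one _))

end GlobalExistence

section LandauZener

set_option linter.unusedSectionVars false

open Set Metric
open scoped NNReal

theorem Vop_apply (G : H →L[ℂ] H) (s : ℝ) (x : WithLp 2 (H × H)) :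
    Vop G s x = WithLp.toLp 2 ((s : ℂ) • x.fst + G x.snd,
      ContinuousLinearMap.adjoint G x.fst - (s : ℂ) • x.snd) := rfl

theorem nlt_apply (f₁ f₂ : ℝ × ℝ → ℝ) (x : WithLp 2 (H × H)) :
    nlt f₁ f₂ x = WithLp.toLp 2 (F1 f₁ x • x.fst, F2 f₂ x • x.snd) := rfl

theorem Vop_eq_add (G : H →L[ℂ] H) (s : ℝ) :
    Vop G s = Vop G 0 + (s : ℂ) • Vop 0 1 := by
  ext x : 1
  apply (WithLp.equiv 2 (H × H)).injective
  ext <;> simp [Vop_apply] <;> abel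

theorem inner_Vop_left (G : H →L[ℂ] H) (s : ℝ) (x : WithLp 2 (H × H)) :
    inner ℂ (Vop G s x) x = inner ℂ x (Vop G s x) := by
  simp only [WithLp.prod_inner_apply, Vop_apply, WithLp.ofLp_fst, WithLp.ofLp_snd,
    inner_add_left, inner_sub_left, inner_add_right, inner_sub_right, inner_smul_left, inner_smul_right, Complex.conj_ofReal,
    ContinuousLinearMap.adjoint_inner_left, ContinuousLinearMap.adjoint_inner_right]
  ring

theorem inner_nlt_left (f₁ f₂ : ℝ × ℝ → ℝ) (x : WithLp 2 (H × H)) :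
    inner ℂ (nlt f₁ f₂ x) x = inner ℂ x (nlt f₁ f₂ x) := by
  simp only [WithLp.prod_inner_apply, nlt_apply, WithLp.ofLp_fst, WithLp.ofLp_snd,
    ← Complex.coe_smul, inner_smul_left, inner_smul_right, Complex.conj_ofReal]

/-- The vector field of the nonlinear Landau–Zener system is tangent to spheres. -/
theorem inner_add_inner_landauZener (G : H →L[ℂ] H) (δ : ℝ) (f₁ f₂ : ℝ × ℝ → ℝ) (s : ℝ)
    (x : WithLp 2 (H × H)) :
    inner ℂ x (Complex.I • (Vop G s x + δ • nlt f₁ f₂ x)) +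
      inner ℂ (Complex.I • (Vop G s x + δ • nlt f₁ f₂ x)) x = 0 := by
  simp only [← Complex.coe_smul, inner_smul_left, inner_smul_right, inner_add_left,
    inner_add_right, inner_Vop_left, inner_nlt_left, Complex.conj_ofReal, Complex.conj_I]
  ring

/-- The map `u ↦ f(‖u₁‖², ‖u₂‖²) • L u`, with `L` a contraction, is Lipschitz on bounded sets. -/
theorem exists_lipschitzOnWith_smul_contraction {f : ℝ × ℝ → ℝ} (hf : ContDiff ℝ 1 f)
    {L : WithLp 2 (H × H) → H} (hL : LipschitzWith 1 L) (hL0 : L 0 = 0) (R : ℝ) :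
    ∃ K : ℝ≥0, LipschitzOnWith K (fun x : WithLp 2 (H × H) => F1 f x • L x) (closedBall 0 R) := by
  set Q : Set (ℝ × ℝ) := Icc 0 (R ^ 2) ×ˢ Icc 0 (R ^ 2)
  have hQ : IsCompact Q := isCompact_Icc.prod isCompact_Icc
  obtain ⟨K, hK⟩ := hf.contDiffOn.exists_lipschitzOnWith (s := Q) one_ne_zero
    ((convex_Icc _ _).prod (convex_Icc _ _)) hQ
  obtain ⟨C, hC⟩ := hQ.exists_bound_of_continuousOn hf.continuous.continuousOn
  have hfst : ∀ x : WithLp 2 (H × H), x ∈ closedBall 0 R → ‖x.fst‖ ≤ R := fun x hx =>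
    (WithLp.norm_fst_le H x).trans (mem_closedBall_zero_iff.1 hx)
  have hsnd : ∀ x : WithLp 2 (H × H), x ∈ closedBall 0 R → ‖x.snd‖ ≤ R := fun x hx =>
    (WithLp.norm_snd_le H x).trans (mem_closedBall_zero_iff.1 hx)
  have hmem : ∀ x : WithLp 2 (H × H), x ∈ closedBall 0 R → (‖x.fst‖ ^ 2, ‖x.snd‖ ^ 2) ∈ Q :=
    fun x hx => ⟨⟨by positivity, pow_le_pow_left₀ (norm_nonneg _) (hfst x hx) 2⟩,
      ⟨by positivity, pow_le_pow_left₀ (norm_nonneg _) (hsnd x hx) 2⟩⟩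
  have hsq : ∀ a b : H, ‖a‖ ≤ R → ‖b‖ ≤ R → |‖a‖ ^ 2 - ‖b‖ ^ 2| ≤ 2 * R * ‖a - b‖ := by
    intro a b ha hb
    rw [sq_sub_sq, abs_mul, abs_of_nonneg (by positivity)]
    have hR : 0 ≤ R := (norm_nonneg a).trans ha
    gcongr
    · linarith
    · exact abs_norm_sub_norm_le a b
  refine ⟨(C + K * (2 * R) * R).toNNReal, LipschitzOnWith.of_dist_le_mul fun x hx y hy => ?_⟩
  have hR : 0 ≤ R := (norm_nonneg _).trans (hfst x hx)
  have hLsub : ‖L x - L y‖ ≤ ‖x - y‖ := by simpa [dist_eq_norm] using hL.dist_le_mul x y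
  have hLy : ‖L y‖ ≤ R := by
    have := hL.dist_le_mul y 0
    rw [hL0] at this
    simpa using this.trans (by simpa using mem_closedBall_zero_iff.1 hy)
  have hF : |F1 f x - F1 f y| ≤ K * (2 * R) * ‖x - y‖ := by
    have h1 := hK.dist_le_mul _ (hmem x hx) _ (hmem y hy)
    rw [Prod.dist_eq, Real.dist_eq, Real.dist_eq, Real.dist_eq] at h1
    refine h1.trans ?_
    rw [mul_assoc]
    gcongr
    refine max_le ((hsq _ _ (hfst x hx) (hfst y hy)).trans ?_)
      ((hsq _ _ (hsnd x hx) (hsnd y hy)).trans ?_)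
    · gcongr
      simpa using WithLp.norm_fst_le H (x - y)
    · gcongr
      simpa using WithLp.norm_snd_le H (x - y)
  have hFx : |F1 f x| ≤ C := hC _ (hmem x hx)
  have hsplit : F1 f x • L x - F1 f y • L y
      = F1 f x • (L x - L y) + (F1 f x - F1 f y) • L y := by
    rw [smul_sub, sub_smul]; abel
  rw [dist_eq_norm, dist_eq_norm, hsplit]
  calc _ ≤ ‖F1 f x • (L x - L y)‖ + ‖(F1 f x - F1 f y) • L y‖ := norm_add_le _ _
    _ ≤ C * ‖x - y‖ + K * (2 * R) * ‖x - y‖ * R := by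
      rw [norm_smul, norm_smul, Real.norm_eq_abs, Real.norm_eq_abs]
      gcongr
      exact (abs_nonneg _).trans hFx
    _ = (C + K * (2 * R) * R) * ‖x - y‖ := by ring
    _ ≤ _ := by
      gcongr
      exact Real.le_coe_toNNReal _

theorem exists_lipschitzOnWith_nlt {f₁ f₂ : ℝ × ℝ → ℝ} (hf₁ : ContDiff ℝ 1 f₁)
    (hf₂ : ContDiff ℝ 1 f₂) (R : ℝ) :
    ∃ K : ℝ≥0, LipschitzOnWith K (nlt f₁ f₂ : WithLp 2 (H × H) → _) (closedBall 0 R) := by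
  obtain ⟨K₁, h₁⟩ := exists_lipschitzOnWith_smul_contraction (H := H) hf₁
    (L := fun x => x.fst) (LipschitzWith.of_dist_le_mul fun x y => by
      simpa [dist_eq_norm] using WithLp.norm_fst_le H (x - y)) rfl R
  obtain ⟨K₂, h₂⟩ := exists_lipschitzOnWith_smul_contraction (H := H) hf₂
    (L := fun x => x.snd) (LipschitzWith.of_dist_le_mul fun x y => by
      simpa [dist_eq_norm] using WithLp.norm_snd_le H (x - y)) rfl R
  exact ⟨_, (WithLp.prod_lipschitzWith_toLp 2 H H).comp_lipschitzOnWith (h₁.prodMk h₂)⟩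

theorem exists_lipschitzWith_Vop (G : H →L[ℂ] H) (T : ℝ) :
    ∃ K : ℝ≥0, ∀ t ∈ Icc (-T) T, LipschitzWith K (Vop G t) := by
  refine ⟨‖Vop G 0‖₊ + T.toNNReal * ‖Vop (0 : H →L[ℂ] H) 1‖₊, fun t ht => ?_⟩
  refine (Vop G t).lipschitz.weaken ?_
  rw [Vop_eq_add]
  refine (nnnorm_add_le _ _).trans ?_
  rw [nnnorm_smul]
  gcongr
  rw [← NNReal.coe_le_coe, coe_nnnorm, Complex.norm_real]
  exact (abs_le.2 ht).trans (Real.le_coe_toNNReal T)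

theorem exists_lipschitzOnWith_landauZener (G : H →L[ℂ] H) (δ : ℝ) {f₁ f₂ : ℝ × ℝ → ℝ}
    (hf₁ : ContDiff ℝ 1 f₁) (hf₂ : ContDiff ℝ 1 f₂) (T R : ℝ) :
    ∃ K : ℝ≥0, ∀ t ∈ Icc (-T) T, LipschitzOnWith K
      (fun x : WithLp 2 (H × H) => Complex.I • (Vop G t x + δ • nlt f₁ f₂ x))
      (closedBall 0 R) := by
  obtain ⟨K₁, h₁⟩ := exists_lipschitzWith_Vop G T
  obtain ⟨K₂, h₂⟩ := exists_lipschitzOnWith_nlt (H := H) hf₁ hf₂ R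
  exact ⟨_, fun t ht => (lipschitzWith_smul Complex.I).comp_lipschitzOnWith
    ((h₁ t ht).lipschitzOnWith.add ((lipschitzWith_smul δ).comp_lipschitzOnWith h₂))⟩

theorem continuous_landauZener (G : H →L[ℂ] H) (δ : ℝ) (f₁ f₂ : ℝ × ℝ → ℝ)
    (x : WithLp 2 (H × H)) :
    Continuous fun t : ℝ => Complex.I • (Vop G t x + δ • nlt f₁ f₂ x) := by
  have h : (fun t : ℝ => Complex.I • (Vop G t x + δ • nlt f₁ f₂ x)) =
      fun t : ℝ => Complex.I • (Vop G 0 x + (t : ℂ) • Vop 0 1 x + δ • nlt f₁ f₂ x) :=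
    funext fun t => by rw [Vop_eq_add]; rfl
  rw [h]
  fun_prop

end LandauZener

/-- global existence, uniqueness and conservation of the `𝓗²`-norm for
the nonlinear Landau–Zener system. -/
theorem stmt_0 (G : H →L[ℂ] H) (δ : ℝ) (f₁ f₂ : ℝ × ℝ → ℝ)
    (hf₁ : C2Bdd f₁) (hf₂ : C2Bdd f₂) (u₀ : WithLp 2 (H × H)) :
    (∃! u : ℝ → WithLp 2 (H × H), u 0 = u₀ ∧ IsLZSol G δ f₁ f₂ u) ∧
      ∀ u : ℝ → WithLp 2 (H × H), u 0 = u₀ → IsLZSol G δ f₁ f₂ u →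
        ∀ s : ℝ, ‖(u s).fst‖ ^ 2 + ‖(u s).snd‖ ^ 2 = ‖u₀.fst‖ ^ 2 + ‖u₀.snd‖ ^ 2 := by
  have hlip := exists_lipschitzOnWith_landauZener G δ
    (hf₁.1.of_le one_le_two) (hf₂.1.of_le one_le_two)
  have htan := inner_add_inner_landauZener G δ f₁ f₂
  refine ⟨?_, fun u hu0 hu s => ?_⟩
  · obtain ⟨u, hu0, hu⟩ := exists_forall_hasDerivAt_of_inner_add_inner_eq_zero (𝕜 := ℂ) hlip
      (continuous_landauZener G δ f₁ f₂) htan u₀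
    exact ⟨u, ⟨hu0, hu⟩, fun w hw => eq_of_forall_hasDerivAt_of_inner_add_inner_eq_zero (𝕜 := ℂ)
      hlip htan hw.2 hu (hw.1.trans hu0.symm)⟩
  · rw [← WithLp.prod_norm_sq_eq_of_L2, ← WithLp.prod_norm_sq_eq_of_L2, ← hu0,
      norm_eq_of_hasDerivAt_of_inner_add_inner_eq_zero (𝕜 := ℂ) hu (fun r => htan r (u r)) s 0]

end
end

section
/- Let R > 0, let u₀ ∈ 𝓗² satisfy Θ_R u₀ = u₀, and let u ∈ C¹(ℝ;𝓗²) be a solution of the nonlinear Landau–Zener system with datum u₀. Then Θ_R u(s) = u(s) for all s ∈ ℝ. -/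
open ContinuousLinearMap Complex Filter Topology
open scoped InnerProductSpace

noncomputable section

variable {H : Type*} [NormedAddCommGroup H] [InnerProductSpace ℂ H] [CompleteSpace H]

/-- Continuous real functions of `GG*` and of `G*G` are intertwined by `G` and by `G*`. -/
theorem CommHyp.cfc_apply {G : H →L[ℂ] H} (hG : CommHyp G) {g : ℝ → ℝ} (hg : Continuous g) :
    (∀ x, cfc g (G * adjoint G) (G x) = G (cfc g (adjoint G * G) x)) ∧
      ∀ x, cfc g (adjoint G * G) (adjoint G x) = adjoint G (cfc g (G * adjoint G) x) := by
  have key : ∀ A : H →L[ℂ] H, fc (fun x => (g x : ℂ)) A = cfc g A := fun A => by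
    simp [fc]
  obtain ⟨h₁, h₂⟩ := hG (fun x => (g x : ℂ)) (by fun_prop)
  rw [key, key] at h₁ h₂
  exact ⟨fun x => DFunLike.congr_fun h₁ x, fun x => DFunLike.congr_fun h₂ x⟩

/-- The flow of `x' = i(αx + Gy)`, `y' = i(G*x + βy)` with real `α, β` preserves the norm. -/
theorem norm_sq_add_norm_sq_eq_of_hasDerivAt (G : H →L[ℂ] H) {α β : ℝ → ℝ} {x y : ℝ → H}
    (hx : ∀ s, HasDerivAt x (I • ((α s : ℂ) • x s + G (y s))) s)
    (hy : ∀ s, HasDerivAt y (I • (adjoint G (x s) + (β s : ℂ) • y s)) s) (s t : ℝ) :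
    ‖x s‖ ^ 2 + ‖y s‖ ^ 2 = ‖x t‖ ^ 2 + ‖y t‖ ^ 2 := by
  let _ : InnerProductSpace ℝ H := InnerProductSpace.rclikeToReal ℂ H
  have hd : ∀ r, HasDerivAt (fun r => ‖x r‖ ^ 2 + ‖y r‖ ^ 2) 0 r := fun r => by
    refine ((hx r).norm_sq.add (hy r).norm_sq).congr_deriv ?_
    have hsymm : (⟪y r, adjoint G (x r)⟫_ℂ).im = -(⟪x r, G (y r)⟫_ℂ).im := by
      rw [adjoint_inner_right, ← inner_conj_symm, conj_im]
    have hre : ∀ a b : H, ⟪a, b⟫_ℝ = (⟪a, b⟫_ℂ).re := fun _ _ => rfl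
    simp [hre, hsymm, ← ofReal_pow]
  exact is_const_of_deriv_eq_zero (fun r => (hd r).differentiableAt) (fun r => (hd r).deriv) s t

/-- propagation of the spectral localization `Θ_R u = u` along the flow. -/
theorem stmt_1 (G : H →L[ℂ] H) (hG : CommHyp G) (δ : ℝ) (f₁ f₂ : ℝ × ℝ → ℝ)
    (hf₁ : C2Bdd f₁) (hf₂ : C2Bdd f₂) (θ : ℝ → ℝ) (hθ : IsCutoff θ)
    (R : ℝ) (hR : 0 < R) (u₀ : WithLp 2 (H × H)) (hu₀ : Theta G θ R u₀ = u₀)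
    (u : ℝ → WithLp 2 (H × H)) (hu : IsLZSol G δ f₁ f₂ u) (hu0 : u 0 = u₀) :
    ∀ s : ℝ, Theta G θ R (u s) = u s := by
  intro s
  have hg : Continuous fun x : ℝ => θ (x / R ^ 2) :=
    hθ.1.continuous.comp (continuous_id.div_const _)
  obtain ⟨hPG, hQG⟩ := hG.cfc_apply hg
  have hfst : ∀ w, (Theta G θ R w).fst =
    cfc (fun x : ℝ => θ (x / R ^ 2)) (G * adjoint G) w.fst := fun _ => rfl
  have hsnd : ∀ w, (Theta G θ R w).snd =
    cfc (fun x : ℝ => θ (x / R ^ 2)) (adjoint G * G) w.snd := fun _ => rfl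
  generalize cfc (fun x : ℝ => θ (x / R ^ 2)) (G * adjoint G) = P at hPG hQG hfst
  generalize cfc (fun x : ℝ => θ (x / R ^ 2)) (adjoint G * G) = Q at hPG hQG hsnd
  have hx : ∀ r, HasDerivAt (fun r => (u r).fst - P (u r).fst)
      (I • (((r + δ * F1 f₁ (u r) : ℝ) : ℂ) • ((u r).fst - P (u r).fst)
        + G ((u r).snd - Q (u r).snd))) r := fun r => by
    have h : HasDerivAt (fun r => (u r).fst)
        (I • (((r : ℂ) • (u r).fst + G (u r).snd) + (δ : ℂ) • (F1 f₁ (u r) : ℂ) • (u r).fst)) r :=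
      ((WithLp.fstL 2 ℂ H H).restrictScalars ℝ).hasFDerivAt.comp_hasDerivAt r (hu r)
    have hP : HasDerivAt (fun r => P (u r).fst) (P _) r :=
      (P.restrictScalars ℝ).hasFDerivAt.comp_hasDerivAt r h
    refine (h.sub hP).congr_deriv ?_
    simp only [map_smul, map_add, map_sub, hPG]
    push_cast
    module
  have hy : ∀ r, HasDerivAt (fun r => (u r).snd - Q (u r).snd)
      (I • (adjoint G ((u r).fst - P (u r).fst)
        + ((-r + δ * F2 f₂ (u r) : ℝ) : ℂ) • ((u r).snd - Q (u r).snd))) r := fun r => by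
    have h : HasDerivAt (fun r => (u r).snd)
        (I • ((adjoint G (u r).fst - (r : ℂ) • (u r).snd)
          + (δ : ℂ) • (F2 f₂ (u r) : ℂ) • (u r).snd)) r :=
      ((WithLp.sndL 2 ℂ H H).restrictScalars ℝ).hasFDerivAt.comp_hasDerivAt r (hu r)
    have hQ : HasDerivAt (fun r => Q (u r).snd) (Q _) r :=
      (Q.restrictScalars ℝ).hasFDerivAt.comp_hasDerivAt r h
    refine (h.sub hQ).congr_deriv ?_
    simp only [map_smul, map_add, map_sub, hQG]
    push_cast
    module
  have hE := norm_sq_add_norm_sq_eq_of_hasDerivAt G hx hy s 0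
  have hP0 : P (u 0).fst = (u 0).fst := by rw [← hfst, hu0, hu₀]
  have hQ0 : Q (u 0).snd = (u 0).snd := by rw [← hsnd, hu0, hu₀]
  have hE' : ‖(u s).fst - P (u s).fst‖ ^ 2 + ‖(u s).snd - Q (u s).snd‖ ^ 2 = 0 := by
    simpa [hP0, hQ0] using hE
  rw [add_eq_zero_iff_of_nonneg (sq_nonneg _) (sq_nonneg _), sq_eq_zero_iff, sq_eq_zero_iff,
    norm_eq_zero, norm_eq_zero, sub_eq_zero, sub_eq_zero] at hE'
  refine (WithLp.equiv 2 (H × H)).injective (Prod.ext ?_ ?_)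
  · exact (hfst _).trans hE'.1.symm
  · exact (hsnd _).trans hE'.2.symm

end
end

section
/- Let R > 0 and let u₀ ∈ 𝓗² satisfy Θ_R u₀ = u₀ and ‖u₁(0)‖² + ‖u₂(0)‖² = 1, and let u be the solution of the nonlinear Landau–Zener system with datum u₀. Then there exist unique pairs ω = (ω₁,ω₂) ∈ 𝓗² and α = (α₁,α₂) ∈ 𝓗², and a constant C > 0 (depending only on R and the fixed data θ, δ, f₁, f₂, G), such that for all s ≥ 1: ‖u₁(s) − e^{iδF₁(ω)s}·e^{iφ(s,GG*)}ω₁‖ ≤ C/s and ‖u₂(s) − e^{iδF₂(ω)s}·e^{−iφ(s,G*G)}ω₂‖ ≤ C/s, and for all s ≤ −1: ‖u₁(s) − e^{iδF₁(α)s}·e^{iφ(s,GG*)}α₁‖ ≤ C/|s| and ‖u₂(s) − e^{iδF₂(α)s}·e^{−iφ(s,G*G)}α₂‖ ≤ C/|s|. -/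
open ContinuousLinearMap Complex Filter Topology
open scoped InnerProductSpace

noncomputable section

variable {H : Type*} [NormedAddCommGroup H] [InnerProductSpace ℂ H] [CompleteSpace H]

/-- If the derivative of `y` on `[1, ∞)` is dominated by `-B'` with `B → 0`, then `y` has a limit,
approached at rate `B`. -/
lemma exists_limit_of_norm_deriv_le {E : Type*} [NormedAddCommGroup E] [NormedSpace ℝ E]
    [CompleteSpace E] {y y' : ℝ → E} {B B' : ℝ → ℝ}
    (hy : ∀ s, 1 ≤ s → HasDerivAt y (y' s) s) (hB : ∀ s, 1 ≤ s → HasDerivAt B (B' s) s)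
    (hB0 : Tendsto B atTop (𝓝 0)) (hle : ∀ s, 1 ≤ s → ‖y' s‖ ≤ -B' s) :
    ∃ l, Tendsto y atTop (𝓝 l) ∧ ∀ s, 1 ≤ s → ‖y s - l‖ ≤ B s := by
  have key : ∀ s t, 1 ≤ s → s ≤ t → ‖y t - y s‖ ≤ B s - B t := by
    intro s t hs hst
    refine image_norm_le_of_norm_deriv_right_le_deriv_boundary' (a := s) (b := t)
      (f := fun x => y x - y s) (f' := y') (B := fun x => B s - B x) (B' := fun x => -B' x)
      ?_ ?_ (by simp) ?_ ?_ ?_ ⟨hst, le_rfl⟩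
    · exact fun x hx => ((hy x (hs.trans hx.1)).continuousAt.sub
        continuousAt_const).continuousWithinAt
    · exact fun x hx => ((hy x (hs.trans hx.1)).sub_const _).hasDerivWithinAt
    · exact fun x hx => (continuousAt_const.sub
        (hB x (hs.trans hx.1)).continuousAt).continuousWithinAt
    · exact fun x hx => ((hB x (hs.trans hx.1)).const_sub _).hasDerivWithinAt
    · exact fun x hx => hle x (hs.trans hx.1)
  have hc : CauchySeq y := by
    rw [Metric.cauchySeq_iff']
    intro ε hε
    obtain ⟨N, hN⟩ := (Metric.tendsto_atTop.1 hB0) (ε / 2) (half_pos hε)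
    refine ⟨max N 1, fun n hn => ?_⟩
    have h1 := key (max N 1) n (le_max_right _ _) hn
    have h2 := hN (max N 1) (le_max_left _ _)
    have h3 := hN n ((le_max_left _ _).trans hn)
    rw [Real.dist_eq, sub_zero] at h2 h3
    rw [dist_eq_norm]
    linarith [abs_lt.1 h2, abs_lt.1 h3, (abs_lt.1 h2).2, (abs_lt.1 h3).1]
  obtain ⟨l, hl⟩ := cauchySeq_tendsto_of_complete hc
  refine ⟨l, hl, fun s hs => ?_⟩
  have h1 : Tendsto (fun t => ‖y t - y s‖) atTop (𝓝 ‖l - y s‖) := (hl.sub_const _).norm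
  have h2 : Tendsto (fun t => B s - B t) atTop (𝓝 (B s - 0)) := hB0.const_sub _
  rw [norm_sub_rev]
  have := le_of_tendsto_of_tendsto h1 h2
    ((eventually_ge_atTop s).mono fun t ht => key s t hs ht)
  simpa using this

lemma hasDerivAt_const_div_pow (C : ℝ) {s : ℝ} (hs : 1 ≤ s) (n : ℕ) :
    HasDerivAt (fun x : ℝ => C / x ^ n) (-(n * C / s ^ (n + 1))) s := by
  have h0 : s ≠ 0 := by positivity
  have := (hasDerivAt_const s C).div (hasDerivAt_pow n s) (pow_ne_zero n h0)
  convert! this using 1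
  rcases n with _ | n
  · simp
  · simp only [Nat.add_sub_cancel]
    field_simp
    ring

lemma tendsto_const_div_pow_atTop (C : ℝ) (n : ℕ) (hn : n ≠ 0) :
    Tendsto (fun x : ℝ => C / x ^ n) atTop (𝓝 0) :=
  tendsto_const_nhds.div_atTop (tendsto_pow_atTop hn)

lemma exists_limit_of_norm_deriv_le_div_sq {E : Type*} [NormedAddCommGroup E] [NormedSpace ℝ E]
    [CompleteSpace E] {y y' : ℝ → E} {C : ℝ}
    (hy : ∀ s, 1 ≤ s → HasDerivAt y (y' s) s) (hle : ∀ s, 1 ≤ s → ‖y' s‖ ≤ C / s ^ 2) :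
    ∃ l, Tendsto y atTop (𝓝 l) ∧ ∀ s, 1 ≤ s → ‖y s - l‖ ≤ C / s := by
  have := exists_limit_of_norm_deriv_le hy (fun s hs => hasDerivAt_const_div_pow C hs 1)
    (tendsto_const_div_pow_atTop C _ one_ne_zero) (fun s hs => by simpa using hle s hs)
  simpa using this

/-- Averaging of the oscillating terms in the population equation: the population `p` of the
first level converges, and so does its renormalised primitive. -/
lemma population_asymptotics {m Mi p q r n : ℝ → ℝ} {K : ℝ}
    (hMi : ∀ x, HasDerivAt Mi (m x) x)
    (hm : ∀ x ∈ Set.Icc (0 : ℝ) 1, |m x| ≤ K)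
    (hMib : ∀ x ∈ Set.Icc (0 : ℝ) 1, |Mi x| ≤ K)
    (hMil : ∀ x ∈ Set.Icc (0 : ℝ) 1, ∀ y ∈ Set.Icc (0 : ℝ) 1, |Mi x - Mi y| ≤ K * |x - y|)
    (hp01 : ∀ s, p s ∈ Set.Icc (0 : ℝ) 1)
    (hr : ∀ s, |r s| ≤ K) (hq : ∀ s, |q s| ≤ K) (hn : ∀ s, |n s| ≤ K)
    (hp' : ∀ s, HasDerivAt p (-2 * q s) s)
    (hr' : ∀ s, HasDerivAt r (2 * (s + m (p s)) * q s) s)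
    (hq' : ∀ s, HasDerivAt q (-2 * (s + m (p s)) * r s + n s) s) :
    ∃ pinf ∈ Set.Icc (0 : ℝ) 1, ∃ c : ℝ, ∃ Q : ℝ → ℝ, (∀ s, HasDerivAt Q (p s) s) ∧
      Tendsto p atTop (𝓝 pinf) ∧
      (∀ s, 1 ≤ s → |p s - pinf| ≤ 4 * K / s) ∧
      ∀ s, 1 ≤ s → |Q s - s * pinf - c| ≤ (5 * K ^ 2 + 3 * K) / s := by
  have hK : 0 ≤ K := (abs_nonneg _).trans (hr 0)
  set Q : ℝ → ℝ := fun s => s * p s + r s + Mi (p s) with hQdef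
  have hQ : ∀ s, HasDerivAt Q (p s) s := by
    intro s
    have := (((hasDerivAt_id s).mul (hp' s)).add (hr' s)).add ((hMi (p s)).comp s (hp' s))
    convert! this using 1
    simp only [id]
    ring
  have hy : ∀ s, 1 ≤ s → HasDerivAt (fun s => Q s / s) (-(r s + Mi (p s)) / s ^ 2) s := by
    intro s hs
    have h0 : s ≠ 0 := by positivity
    convert! (hQ s).div (hasDerivAt_id s) h0 using 1
    simp only [hQdef, id]
    congr 1
    ring
  obtain ⟨pinf, hpinf, hpb⟩ := exists_limit_of_norm_deriv_le_div_sq (C := 2 * K) hy (by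
    intro s hs
    rw [Real.norm_eq_abs, abs_div, abs_neg, abs_of_pos (by positivity : 0 < s ^ 2)]
    gcongr
    linarith [abs_add_le (r s) (Mi (p s)), hr s, hMib _ (hp01 s)])
  have hpy : ∀ s, 1 ≤ s → |p s - Q s / s| ≤ 2 * K / s := by
    intro s hs
    have h0 : s ≠ 0 := by positivity
    have : p s - Q s / s = -(r s + Mi (p s)) / s := by
      simp only [hQdef]; field_simp; ring
    rw [this, abs_div, abs_neg, abs_of_pos (by positivity : 0 < s)]
    gcongr
    linarith [abs_add_le (r s) (Mi (p s)), hr s, hMib _ (hp01 s)]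
  have hpp : ∀ s, 1 ≤ s → |p s - pinf| ≤ 4 * K / s := by
    intro s hs
    have h1 := hpy s hs
    have h2 := hpb s hs
    rw [Real.norm_eq_abs] at h2
    have h3 := abs_sub_le (p s) (Q s / s) pinf
    have h4 : 4 * K / s = 2 * K / s + 2 * K / s := by ring
    linarith
  have hpt : Tendsto p atTop (𝓝 pinf) := by
    rw [tendsto_iff_norm_sub_tendsto_zero]
    refine squeeze_zero' (Eventually.of_forall fun _ => norm_nonneg _)
      ((eventually_ge_atTop 1).mono fun s hs => hpp s hs) ?_
    simpa using tendsto_const_div_pow_atTop (4 * K) _ one_ne_zero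
  have hpm : pinf ∈ Set.Icc (0 : ℝ) 1 :=
    isClosed_Icc.mem_of_tendsto hpt (Eventually.of_forall hp01)
  refine ⟨pinf, hpm, Mi pinf, Q, hQ, hpt, hpp, ?_⟩
  set c := Mi pinf with hc
  set κ : ℝ → ℝ := fun s => Q s / s - pinf - c / s ^ 1 - (1 / 2 / s ^ 3) * q s with hκ
  have hκ' : ∀ s, 1 ≤ s → HasDerivAt κ (-(Mi (p s) - c) / s ^ 2 + m (p s) * r s / s ^ 3
      - n s / (2 * s ^ 3) + 3 * q s / (2 * s ^ 4)) s := by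
    intro s hs
    have h0 : s ≠ 0 := by positivity
    have := (((hy s hs).sub_const pinf).sub (hasDerivAt_const_div_pow c hs 1)).sub
      ((hasDerivAt_const_div_pow (1 / 2) hs 3).mul (hq' s))
    convert! this using 1
    push_cast
    field_simp
    ring
  have hκb : ∀ s, 1 ≤ s → ‖-(Mi (p s) - c) / s ^ 2 + m (p s) * r s / s ^ 3
      - n s / (2 * s ^ 3) + 3 * q s / (2 * s ^ 4)‖ ≤ (5 * K ^ 2 + 2 * K) / s ^ 3 := by
    intro s hs
    have h0 : 0 < s := by positivity
    have e1 : |-(Mi (p s) - c) / s ^ 2| ≤ 4 * K ^ 2 / s ^ 3 := by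
      rw [abs_div, abs_neg, abs_of_pos (by positivity : 0 < s ^ 2)]
      have : |Mi (p s) - c| ≤ K * (4 * K / s) :=
        (hMil _ (hp01 s) _ hpm).trans (by gcongr; exact hpp s hs)
      calc _ ≤ K * (4 * K / s) / s ^ 2 := by gcongr
        _ = _ := by field_simp
    have e2 : |m (p s) * r s / s ^ 3| ≤ K ^ 2 / s ^ 3 := by
      rw [abs_div, abs_mul, abs_of_pos (by positivity : 0 < s ^ 3), pow_two]
      gcongr
      exacts [hm _ (hp01 s), hr s]
    have e3 : |n s / (2 * s ^ 3)| ≤ (K / 2) / s ^ 3 := by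
      rw [abs_div, abs_of_pos (by positivity : 0 < 2 * s ^ 3), div_div]
      gcongr
      exact hn s
    have e4 : |3 * q s / (2 * s ^ 4)| ≤ (3 * K / 2) / s ^ 3 := by
      rw [abs_div, abs_of_pos (by positivity : 0 < 2 * s ^ 4), div_div, abs_mul]
      gcongr
      · norm_num
      · exact hq s
      · norm_num
    have h5 : (5 * K ^ 2 + 2 * K) / s ^ 3
        = 4 * K ^ 2 / s ^ 3 + K ^ 2 / s ^ 3 + (K / 2) / s ^ 3 + (3 * K / 2) / s ^ 3 := by ring
    rw [h5, Real.norm_eq_abs]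
    refine (abs_add_le _ _).trans (add_le_add ((abs_sub _ _).trans (add_le_add
      ((abs_add_le _ _).trans (add_le_add e1 e2)) e3)) e4)
  obtain ⟨l, hl, hlb⟩ := exists_limit_of_norm_deriv_le hκ'
    (fun s hs => hasDerivAt_const_div_pow ((5 * K ^ 2 + 2 * K) / 2) hs 2)
    (tendsto_const_div_pow_atTop _ _ two_ne_zero)
    (fun s hs => (hκb s hs).trans (le_of_eq (by push_cast; ring)))
  have hκ0 : Tendsto κ atTop (𝓝 0) := by
    have h1 : Tendsto (fun s => (1 / 2 / s ^ 3) * q s) atTop (𝓝 0) := by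
      refine (tendsto_const_div_pow_atTop (1 / 2) _ three_ne_zero).zero_mul_isBoundedUnder_le ?_
      exact isBoundedUnder_of ⟨K, fun s => hq s⟩
    have := ((hpinf.sub_const pinf).sub (tendsto_const_div_pow_atTop c _ one_ne_zero)).sub h1
    simpa only [sub_self, sub_zero] using this
  obtain rfl := tendsto_nhds_unique hl hκ0
  intro s hs
  have h0 : 0 < s := by positivity
  have h1 := hlb s hs
  rw [sub_zero, Real.norm_eq_abs] at h1
  have h2 : Q s - s * pinf - c = s * κ s + q s / (2 * s ^ 2) := by
    simp only [hκ]; field_simp; ring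
  rw [h2]
  have e1 : |s * κ s| ≤ (5 * K ^ 2 + 2 * K) / s := by
    rw [abs_mul, abs_of_pos h0]
    calc s * |κ s| ≤ s * ((5 * K ^ 2 + 2 * K) / 2 / s ^ 2) := by gcongr
      _ = (5 * K ^ 2 + 2 * K) / (2 * s) := by field_simp
      _ ≤ _ := by gcongr; linarith
  have e2 : |q s / (2 * s ^ 2)| ≤ K / s := by
    rw [abs_div, abs_of_pos (by positivity : 0 < 2 * s ^ 2)]
    gcongr
    · exact hq s
    · nlinarith
  calc _ ≤ _ := abs_add_le _ _
    _ ≤ (5 * K ^ 2 + 2 * K) / s + K / s := add_le_add e1 e2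
    _ = _ := by ring

/-- A primitive `Φ` of `g ∘ p` has an affine asymptote of slope `g (lim p)`. -/
lemma phase_asymptotics {g p Q Φ : ℝ → ℝ} {K pinf c d : ℝ} (hd : |d| ≤ K)
    (hg : ∀ x ∈ Set.Icc (0 : ℝ) 1, |g x - g pinf - d * (x - pinf)| ≤ K * (x - pinf) ^ 2)
    (hp01 : ∀ s, p s ∈ Set.Icc (0 : ℝ) 1) (hQ : ∀ s, HasDerivAt Q (p s) s)
    (hp : ∀ s, 1 ≤ s → |p s - pinf| ≤ 4 * K / s)
    (hQb : ∀ s, 1 ≤ s → |Q s - s * pinf - c| ≤ (5 * K ^ 2 + 3 * K) / s)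
    (hΦ : ∀ s, HasDerivAt Φ (g (p s)) s) :
    ∃ c' : ℝ, ∀ s, 1 ≤ s → |Φ s - s * g pinf - c'| ≤ (21 * K ^ 3 + 3 * K ^ 2) / s := by
  have hK : 0 ≤ K := (abs_nonneg _).trans hd
  have h' : ∀ s, 1 ≤ s → HasDerivAt (fun s => Φ s - s * g pinf - d * (Q s - s * pinf))
      (g (p s) - g pinf - d * (p s - pinf)) s := by
    intro s _
    have := ((hΦ s).sub ((hasDerivAt_id s).mul_const (g pinf))).sub
      (((hQ s).sub ((hasDerivAt_id s).mul_const pinf)).const_mul d)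
    convert! this using 1
    ring
  obtain ⟨l, -, hl⟩ := exists_limit_of_norm_deriv_le_div_sq (C := 16 * K ^ 3) h' (by
    intro s hs
    have h0 : 0 < s := by positivity
    rw [Real.norm_eq_abs]
    refine (hg _ (hp01 s)).trans ?_
    calc K * (p s - pinf) ^ 2 = K * |p s - pinf| ^ 2 := by rw [sq_abs]
      _ ≤ K * (4 * K / s) ^ 2 := by gcongr; exact hp s hs
      _ = _ := by field_simp; ring)
  refine ⟨l + d * c, fun s hs => ?_⟩
  have h1 := hl s hs
  rw [Real.norm_eq_abs] at h1
  have h0 : 0 < s := by positivity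
  have e : Φ s - s * g pinf - (l + d * c) = (Φ s - s * g pinf - d * (Q s - s * pinf) - l)
      + d * (Q s - s * pinf - c) := by ring
  rw [e]
  calc _ ≤ _ := abs_add_le _ _
    _ ≤ 16 * K ^ 3 / s + K * ((5 * K ^ 2 + 3 * K) / s) := by
      rw [abs_mul]
      gcongr
      exact hQb s hs
    _ = _ := by ring

/-- The unitary group `e^{itT}` generated by a selfadjoint operator `T`. -/
def unitaryGroup (T : H →L[ℂ] H) (t : ℝ) : H →L[ℂ] H :=
  NormedSpace.exp (t • (Complex.I • T))

lemma norm_unitaryGroup_apply {T : H →L[ℂ] H} (hT : IsSelfAdjoint T) (t : ℝ) (x : H) :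
    ‖unitaryGroup T t x‖ = ‖x‖ := by
  have h1 : IsSelfAdjoint ((t : ℂ) • T) := by
    rw [IsSelfAdjoint, star_smul, hT.star_eq]
    simp
  have h2 := selfAdjoint.expUnitary_coe (⟨(t : ℂ) • T, h1⟩ : selfAdjoint (H →L[ℂ] H))
  have h3 : unitaryGroup T t = NormedSpace.exp (Complex.I • ((t : ℂ) • T)) := by
    rw [unitaryGroup, smul_comm Complex.I (t : ℂ) T, Complex.coe_smul]
  have h4 : unitaryGroup T t ∈ unitary (H →L[ℂ] H) := by
    rw [h3, ← h2]
    exact Subtype.property _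
  exact ContinuousLinearMap.norm_map_of_mem_unitary h4 x

lemma unitaryGroup_neg_apply (T : H →L[ℂ] H) (t : ℝ) (x : H) :
    unitaryGroup T t (unitaryGroup T (-t) x) = x := by
  have : unitaryGroup T t * unitaryGroup T (-t) = 1 := by
    let := NormedAlgebra.restrictScalars ℚ ℂ (H →L[ℂ] H)
    rw [unitaryGroup, unitaryGroup, ← NormedSpace.exp_add_of_commute]
    · simp
    · exact ((Commute.refl _).smul_left _).smul_right _
  exact congrArg (fun A => A x) this

lemma hasDerivAt_unitaryGroup_apply (T : H →L[ℂ] H) {τ : ℝ → ℝ} {τ' : ℝ} {y : ℝ → H} {y' : H}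
    {s : ℝ} (hτ : HasDerivAt τ τ' s) (hy : HasDerivAt y y' s) :
    HasDerivAt (fun s => unitaryGroup T (τ s) (y s))
      (unitaryGroup T (τ s) (y' + ((τ' : ℂ) * Complex.I) • T (y s))) s := by
  have h1 : HasDerivAt (fun t : ℝ => unitaryGroup T t)
      (unitaryGroup T (τ s) * (Complex.I • T)) (τ s) :=
    hasDerivAt_exp_smul_const (𝕂 := ℝ) (Complex.I • T) (τ s)
  have h2 := h1.scomp s hτ
  have h3 : HasDerivAt (fun s => (unitaryGroup T (τ s)).restrictScalars ℝ)
      ((τ' • (unitaryGroup T (τ s) * (Complex.I • T))).restrictScalars ℝ) s :=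
    (ContinuousLinearMap.restrictScalarsL ℂ H H ℝ ℝ).hasFDerivAt.comp_hasDerivAt s h2
  have h4 := h3.clm_apply hy
  convert! h4 using 1
  simp [mul_smul, add_comm]

lemma fc_eq_cfc {χ : ℝ → ℂ} (hχ : Continuous χ) {T : H →L[ℂ] H} (hT : IsSelfAdjoint T) :
    fc χ T = cfc (fun z : ℂ => χ z.re) T := by
  have : IsStarNormal T := hT.isStarNormal
  rw [fc, cfc_real_eq_complex _ hT, cfc_real_eq_complex _ hT,
    ← cfc_const_mul _ _ _ (by fun_prop), ← cfc_add _ _ _ (by fun_prop) (by fun_prop)]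
  congr 1
  ext z
  rw [mul_comm]
  exact Complex.re_add_im _

lemma fc_exp_eq {T : H →L[ℂ] H} (hT : IsSelfAdjoint T) (c t : ℝ) :
    fc (fun x => Complex.exp (Complex.I * (c + t * x))) T
      = Complex.exp (Complex.I * c) • unitaryGroup T t := by
  have hn : IsStarNormal T := hT.isStarNormal
  have hn' : IsStarNormal (t • (Complex.I • T)) := by
    rw [smul_comm]
    constructor
    simp [Commute, SemiconjBy, hT.star_eq]
  rw [fc_eq_cfc (by fun_prop) hT, unitaryGroup, ← CFC.complex_exp_eq_normedSpace_exp hn']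
  have h1 : t • (Complex.I • T) = cfc (fun z : ℂ => (t * Complex.I) * z) T := by
    rw [cfc_const_mul_id _ _ hn, mul_smul]
    rfl
  rw [h1, ← cfc_comp' Complex.exp _ T (by fun_prop) (by fun_prop) hn,
    ← cfc_const_mul _ _ _ (by fun_prop)]
  refine cfc_congr fun z hz => ?_
  have : z = z.re := hT.mem_spectrum_eq_re hz
  change Complex.exp _ = Complex.exp _ * Complex.exp _
  rw [← Complex.exp_add]
  congr 1
  conv_rhs => rw [this]
  ring

lemma isSelfAdjoint_mul_adjoint (G : H →L[ℂ] H) :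
    IsSelfAdjoint (G * ContinuousLinearMap.adjoint G) :=
  IsSelfAdjoint.mul_star_self G

lemma isSelfAdjoint_adjoint_mul (G : H →L[ℂ] H) :
    IsSelfAdjoint (ContinuousLinearMap.adjoint G * G) :=
  IsSelfAdjoint.star_mul_self G

lemma ePhaseP_eq (G : H →L[ℂ] H) (s : ℝ) :
    ePhaseP G s = Complex.exp (Complex.I * ((s ^ 2 / 2 : ℝ) : ℂ)) •
      unitaryGroup (G * ContinuousLinearMap.adjoint G) (Real.log |s| / 2) := by
  rw [← fc_exp_eq (isSelfAdjoint_mul_adjoint G), ePhaseP]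
  congr 1
  ext x
  simp only [phase]
  push_cast
  ring_nf

lemma ePhaseM_eq (G : H →L[ℂ] H) (s : ℝ) :
    ePhaseM G s = Complex.exp (Complex.I * ((-(s ^ 2 / 2) : ℝ) : ℂ)) •
      unitaryGroup (ContinuousLinearMap.adjoint G * G) (-(Real.log |s| / 2)) := by
  rw [← fc_exp_eq (isSelfAdjoint_adjoint_mul G), ePhaseM]
  congr 1
  ext x
  simp only [phase]
  push_cast
  ring_nf

/-- Adiabatic decoupling: after removal of its oscillating part, `a` solves the scattering equation
`A' = (iε / 2s) L L* A` up to an integrable error. -/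
lemma amplitude_asymptotics {L : H →L[ℂ] H} {K ε : ℝ} {a b : ℝ → H} {ψ m m' : ℝ → ℝ}
    (hε : |ε| = 1) (hL : ‖L‖ ≤ K) (hm : ∀ s, |m s| ≤ K) (hm' : ∀ s, |m' s| ≤ K)
    (hmd : ∀ s, HasDerivAt m (m' s) s) (hψ : ∀ s, HasDerivAt ψ (2 * ε * (s + m s)) s)
    (ha : ∀ s, ‖a s‖ ≤ 1) (hb : ∀ s, ‖b s‖ ≤ 1)
    (had : ∀ s, HasDerivAt a
      ((Complex.I * Complex.exp (-(Complex.I * ψ s))) • L (b s)) s)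
    (hbd : ∀ s, HasDerivAt b
      ((Complex.I * Complex.exp (Complex.I * ψ s)) • ContinuousLinearMap.adjoint L (a s)) s) :
    ∃ β : H, ∀ s, 1 ≤ s →
      ‖a s - unitaryGroup (L * ContinuousLinearMap.adjoint L) (ε * (Real.log s / 2)) β‖
        ≤ ((K ^ 2 + (1 / 2 + K / 2 + K)) * K + K / 2 * K ^ 2 + (1 / 2 + K / 2) / 2 * K ^ 3
          + (1 / 2 + K / 2) * K) / s := by
  have hK : 0 ≤ K := (norm_nonneg _).trans hL
  have hε2 : ε ^ 2 = 1 := by rw [← sq_abs, hε, one_pow]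
  set T := L * ContinuousLinearMap.adjoint L with hT
  have hTs : IsSelfAdjoint T := isSelfAdjoint_mul_adjoint L
  have hLb : ∀ x y, ‖x‖ ≤ y → ‖L x‖ ≤ K * y := fun x y hxy =>
    (L.le_opNorm x).trans (mul_le_mul hL hxy (norm_nonneg _) hK)
  have hL'b : ∀ x y, ‖x‖ ≤ y → ‖ContinuousLinearMap.adjoint L x‖ ≤ K * y := fun x y hxy =>
    ((ContinuousLinearMap.adjoint L).le_opNorm x).trans
      (mul_le_mul (by rwa [LinearIsometryEquiv.norm_map]) hxy (norm_nonneg _) hK)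
  have hTb : ∀ x y, ‖x‖ ≤ y → ‖T x‖ ≤ K ^ 2 * y := fun x y hxy => by
    rw [pow_two, mul_assoc]
    exact hLb _ _ (hL'b _ _ hxy)
  set k : ℝ → ℝ := fun s => ε * (1 / 2 / s ^ 1 - (1 / 2 / s ^ 2) * m s) with hk
  set k' : ℝ → ℝ := fun s => ε * (-1 / 2 / s ^ 2 + m s / s ^ 3 - m' s / 2 / s ^ 2) with hk'
  have hkd : ∀ s, 1 ≤ s → HasDerivAt k (k' s) s := by
    intro s hs
    have h0 : s ≠ 0 := by positivity
    have := ((hasDerivAt_const_div_pow (1 / 2) hs 1).sub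
      ((hasDerivAt_const_div_pow (1 / 2) hs 2).mul (hmd s))).const_mul ε
    convert! this using 1
    simp only [hk']
    push_cast
    field_simp
    ring
  have hkb : ∀ s, 1 ≤ s → |k s| ≤ (1 / 2 + K / 2) / s := by
    intro s hs
    have h0 : 0 < s := by positivity
    rw [hk, abs_mul, hε, one_mul, add_div]
    refine (abs_sub _ _).trans (add_le_add ?_ ?_)
    · rw [pow_one, abs_of_pos (by positivity)]
    · rw [abs_mul, abs_of_pos (by positivity : 0 < 1 / 2 / s ^ 2)]
      calc 1 / 2 / s ^ 2 * |m s| ≤ 1 / 2 / s ^ 2 * K := by gcongr; exact hm s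
        _ = K / 2 / s ^ 2 := by ring
        _ ≤ K / 2 / s ^ 1 := by gcongr; norm_num
        _ = _ := by rw [pow_one]
  have hk'b : ∀ s, 1 ≤ s → |k' s| ≤ (1 / 2 + K / 2 + K) / s ^ 2 := by
    intro s hs
    have h0 : 0 < s := by positivity
    rw [hk', abs_mul, hε, one_mul]
    have e1 : |-1 / 2 / s ^ 2| ≤ 1 / 2 / s ^ 2 := by
      rw [abs_div, abs_of_pos (by positivity : 0 < s ^ 2)]
      norm_num
    have e2 : |m s / s ^ 3| ≤ K / s ^ 2 := by
      rw [abs_div, abs_of_pos (by positivity : 0 < s ^ 3)]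
      gcongr
      · exact hm s
      · norm_num
    have e3 : |m' s / 2 / s ^ 2| ≤ K / 2 / s ^ 2 := by
      rw [abs_div, abs_div, abs_of_pos (by positivity : 0 < s ^ 2), abs_two]
      gcongr
      exact hm' s
    calc _ ≤ 1 / 2 / s ^ 2 + K / s ^ 2 + K / 2 / s ^ 2 :=
          (abs_sub _ _).trans (add_le_add ((abs_add_le _ _).trans (add_le_add e1 e2)) e3)
      _ = _ := by ring
  set e : ℝ → ℂ := fun s => Complex.exp (-(Complex.I * ψ s)) with he
  have he1 : ∀ s, ‖e s‖ = 1 := fun s => by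
    simp only [he]
    rw [← mul_neg, ← Complex.ofReal_neg, mul_comm, Complex.norm_exp_ofReal_mul_I]
  have hee : ∀ s, e s * Complex.exp (Complex.I * ψ s) = 1 := fun s => by
    simp only [he]
    rw [← Complex.exp_add, neg_add_cancel, Complex.exp_zero]
  have hed : ∀ s, HasDerivAt e (-(Complex.I * (2 * ε * (s + m s) : ℝ)) * e s) s := by
    intro s
    have := (((hψ s).ofReal_comp.const_mul Complex.I).neg).cexp
    rwa [mul_comm] at this
  set A : ℝ → H := fun s => a s + ((k s : ℂ) * e s) • L (b s) with hA
  set Err : ℝ → H := fun s =>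
    ((Complex.I * (m s ^ 2 / s ^ 2 : ℝ) + (k' s : ℝ)) * e s) • L (b s)
      - (Complex.I * (ε * m s / 2 / s ^ 2 : ℝ)) • T (a s)
      - (Complex.I * (ε / 2 / s * k s : ℝ) * e s) • T (L (b s)) with hErr
  have hAd : ∀ s, 1 ≤ s → HasDerivAt A
      (Err s + ((ε / 2 / s : ℝ) * Complex.I) • T (A s)) s := by
    intro s hs
    have h0 : (s : ℂ) ≠ 0 := by
      norm_cast
      positivity
    have hLd : HasDerivAt (fun s => L (b s)) (L ((Complex.I * Complex.exp (Complex.I * ψ s)) •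
        ContinuousLinearMap.adjoint L (a s))) s :=
      (L.restrictScalars ℝ).hasFDerivAt.comp_hasDerivAt s (hbd s)
    have h1 := (had s).add ((((hkd s hs).ofReal_comp).mul (hed s)).smul hLd)
    convert! h1 using 1
    have hTL : T (a s) = L (ContinuousLinearMap.adjoint L (a s)) := rfl
    have hcoef : ((k s : ℂ) * e s) • L ((Complex.I * Complex.exp (Complex.I * ψ s)) •
        ContinuousLinearMap.adjoint L (a s)) = ((k s : ℂ) * Complex.I) • T (a s) := by
      rw [map_smul, smul_smul, hTL]
      congr 1
      linear_combination (k s : ℂ) * Complex.I * hee s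
    have hε2' : (ε : ℂ) ^ 2 = 1 := by exact_mod_cast hε2
    have hks : (k s : ℂ) = ε * (1 / 2 / s - m s / 2 / s ^ 2) := by
      simp only [hk]; push_cast; ring
    have hexp : Complex.exp (-(Complex.I * ψ s)) = e s := rfl
    change _ = _ + (((k s : ℂ) * e s) • L ((Complex.I * Complex.exp (Complex.I * ψ s)) •
        ContinuousLinearMap.adjoint L (a s)) + _)
    rw [hcoef, hexp]
    simp only [hErr, hA, map_add, map_smul]
    match_scalars
    · rw [hks]
      field_simp
      linear_combination Complex.I * e s * ((s : ℂ) ^ 2 - m s ^ 2) * hε2'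
    · rw [hks]
      field_simp
      ring
    · field_simp
      ring
  have hErrb : ∀ s, 1 ≤ s → ‖Err s‖ ≤ ((K ^ 2 + (1 / 2 + K / 2 + K)) * K + K / 2 * K ^ 2
      + (1 / 2 + K / 2) / 2 * K ^ 3) / s ^ 2 := by
    intro s hs
    have h0 : 0 < s := by positivity
    have hLs := hLb _ _ (hb s)
    have hTs := hTb _ _ (ha s)
    have hTLs := hTb _ _ hLs
    rw [mul_one] at hLs hTs hTLs
    have e1 : ‖((Complex.I * (m s ^ 2 / s ^ 2 : ℝ) + (k' s : ℝ)) * e s) • L (b s)‖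
        ≤ (K ^ 2 / s ^ 2 + (1 / 2 + K / 2 + K) / s ^ 2) * K := by
      rw [norm_smul, norm_mul, he1, mul_one]
      gcongr
      refine (norm_add_le _ _).trans (add_le_add ?_ ?_)
      · rw [norm_mul, Complex.norm_I, one_mul, Complex.norm_real, Real.norm_eq_abs, abs_div,
          abs_pow, abs_of_pos (by positivity : 0 < s ^ 2)]
        gcongr
        exact hm s
      · rw [Complex.norm_real]
        exact hk'b s hs
    have e2 : ‖(Complex.I * (ε * m s / 2 / s ^ 2 : ℝ)) • T (a s)‖ ≤ K / 2 / s ^ 2 * K ^ 2 := by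
      rw [norm_smul, norm_mul, Complex.norm_I, one_mul, Complex.norm_real, Real.norm_eq_abs,
        abs_div, abs_div, abs_mul, hε, one_mul, abs_two, abs_of_pos (by positivity : 0 < s ^ 2)]
      gcongr
      exact hm s
    have e3 : ‖(Complex.I * (ε / 2 / s * k s : ℝ) * e s) • T (L (b s))‖
        ≤ 1 / 2 / s * ((1 / 2 + K / 2) / s) * (K ^ 2 * K) := by
      rw [norm_smul, norm_mul, he1, mul_one, norm_mul, Complex.norm_I, one_mul, Complex.norm_real,
        Real.norm_eq_abs, abs_mul, abs_div, abs_div, hε, abs_two, abs_of_pos h0]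
      gcongr
      exact hkb s hs
    calc ‖Err s‖ ≤ _ := (norm_sub_le _ _).trans
          (add_le_add ((norm_sub_le _ _).trans (add_le_add e1 e2)) e3)
      _ = _ := by ring
  set τ : ℝ → ℝ := fun s => ε * (Real.log s / 2) with hτ
  have hBd : ∀ s, 1 ≤ s → HasDerivAt (fun s => unitaryGroup T (-τ s) (A s))
      (unitaryGroup T (-τ s) (Err s)) s := by
    intro s hs
    have h0 : s ≠ 0 := by positivity
    have h1 : HasDerivAt (fun s => -τ s) (-(ε * (s⁻¹ / 2))) s :=
      (((Real.hasDerivAt_log h0).div_const 2).const_mul ε).neg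
    have := hasDerivAt_unitaryGroup_apply T h1 (hAd s hs)
    convert! this using 2
    rw [add_assoc, ← add_smul]
    convert (add_zero _).symm using 2
    convert zero_smul ℂ _ using 2
    push_cast
    ring
  obtain ⟨β, -, hβ⟩ := exists_limit_of_norm_deriv_le_div_sq hBd (fun s hs => by
    rw [norm_unitaryGroup_apply hTs]
    exact hErrb s hs)
  refine ⟨β, fun s hs => ?_⟩
  have h0 : 0 < s := by positivity
  have h1 : ‖A s - unitaryGroup T (τ s) β‖ = ‖unitaryGroup T (-τ s) (A s) - β‖ := by
    rw [← norm_unitaryGroup_apply hTs (τ s) (_ - β), map_sub, unitaryGroup_neg_apply]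
  have h2 : ‖a s - A s‖ ≤ (1 / 2 + K / 2) / s * K := by
    have : a s - A s = -(((k s : ℂ) * e s) • L (b s)) := by simp only [hA]; abel
    rw [this, norm_neg, norm_smul, norm_mul, he1, mul_one, Complex.norm_real]
    have := hLb _ _ (hb s)
    rw [mul_one] at this
    gcongr
    exact hkb s hs
  calc _ ≤ ‖a s - A s‖ + ‖A s - unitaryGroup T (τ s) β‖ := norm_sub_le_norm_sub_add_norm_sub _ _ _
    _ ≤ _ := add_le_add h2 (h1.trans_le (hβ s hs))
    _ = _ := by ring

/-- Bounds on the unit interval for a `C²` function, including the second-order Taylor estimate. -/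
lemma exists_taylor_bound {g : ℝ → ℝ} (hg : ContDiff ℝ 2 g) :
    ∃ K, 0 ≤ K ∧ (∀ x ∈ Set.Icc (0 : ℝ) 1, |g x| ≤ K ∧ |deriv g x| ≤ K) ∧
      ∀ x ∈ Set.Icc (0 : ℝ) 1, ∀ y ∈ Set.Icc (0 : ℝ) 1,
        |g x - g y - deriv g y * (x - y)| ≤ K * (x - y) ^ 2 := by
  have hd : ContDiff ℝ 1 (deriv g) := ((contDiff_succ_iff_deriv (n := 1)).1 (by rw [one_add_one_eq_two]; exact hg)).2.2
  have hdd : Continuous (deriv (deriv g)) := hd.continuous_deriv le_rfl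
  obtain ⟨K₀, h0⟩ := isCompact_Icc.exists_bound_of_continuousOn
    (s := Set.Icc (0 : ℝ) 1) hg.continuous.continuousOn
  obtain ⟨K₁, h1⟩ := isCompact_Icc.exists_bound_of_continuousOn
    (s := Set.Icc (0 : ℝ) 1) hd.continuous.continuousOn
  obtain ⟨K₂, h2⟩ := isCompact_Icc.exists_bound_of_continuousOn
    (s := Set.Icc (0 : ℝ) 1) hdd.continuousOn
  have hz : (0 : ℝ) ∈ Set.Icc (0 : ℝ) 1 := by simp
  have p0 := (norm_nonneg _).trans (h0 0 hz)
  have p1 := (norm_nonneg _).trans (h1 0 hz)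
  have p2 := (norm_nonneg _).trans (h2 0 hz)
  refine ⟨K₀ + K₁ + K₂, by positivity, fun x hx => ⟨?_, ?_⟩, fun x hx y hy => ?_⟩
  · have := h0 x hx
    rw [Real.norm_eq_abs] at this
    linarith
  · have := h1 x hx
    rw [Real.norm_eq_abs] at this
    linarith
  have hsub : Set.uIcc y x ⊆ Set.Icc 0 1 := Set.uIcc_subset_Icc hy hx
  have hlip : ∀ z ∈ Set.uIcc y x, ‖deriv g z - deriv g y‖ ≤ K₂ * |x - y| := by
    intro z hz
    have := (convex_Icc (0 : ℝ) 1).norm_image_sub_le_of_norm_deriv_le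
      (fun w _ => hd.differentiable one_ne_zero w) h2 hy (hsub hz)
    refine this.trans ?_
    gcongr
    exact Set.abs_sub_left_of_mem_uIcc hz
  have hmain := (convex_uIcc y x).norm_image_sub_le_of_norm_hasDerivWithin_le
    (f := fun z => g z - deriv g y * z) (f' := fun z => deriv g z - deriv g y)
    (fun z _ => (((hg.differentiable two_ne_zero z).hasDerivAt.sub
      ((hasDerivAt_id z).const_mul (deriv g y))).hasDerivWithinAt.congr_deriv (by simp)))
    hlip Set.left_mem_uIcc Set.right_mem_uIcc
  rw [Real.norm_eq_abs, Real.norm_eq_abs] at hmain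
  calc |g x - g y - deriv g y * (x - y)|
      = |g x - deriv g y * x - (g y - deriv g y * y)| := by ring_nf
    _ ≤ K₂ * |x - y| * |x - y| := hmain
    _ = K₂ * (x - y) ^ 2 := by rw [mul_assoc, abs_mul_abs_self, pow_two]
    _ ≤ _ := by gcongr; linarith

lemma hasDerivAt_norm_sq_of_ode {H : Type*} [NormedAddCommGroup H] [InnerProductSpace ℂ H] {u : ℝ → H} {w : H} {κ s : ℝ}
    (h : HasDerivAt u (Complex.I • ((κ : ℂ) • u s + w)) s) :
    HasDerivAt (fun s => ‖u s‖ ^ 2) (-2 * (⟪u s, w⟫_ℂ).im) s := by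
  have h1 : ∀ t, ‖u t‖ ^ 2 = (⟪u t, u t⟫_ℂ).re := fun t => (inner_self_eq_norm_sq (𝕜 := ℂ) _).symm
  simp only [h1]
  convert! Complex.reCLM.hasFDerivAt.comp_hasDerivAt s (h.inner ℂ h) using 1
  have h2 : (⟪w, u s⟫_ℂ).im = -(⟪u s, w⟫_ℂ).im := by rw [← inner_conj_symm, Complex.conj_im]
  simp only [inner_smul_right, inner_smul_left, inner_add_right, inner_add_left]
  simp [h2]
  ring

lemma hasDerivAt_inner_of_ode {G : H →L[ℂ] H} {u₁ u₂ : ℝ → H} {κ₁ κ₂ s : ℝ}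
    (h1 : HasDerivAt u₁ (Complex.I • ((κ₁ : ℂ) • u₁ s + G (u₂ s))) s)
    (h2 : HasDerivAt u₂ (Complex.I • ((κ₂ : ℂ) • u₂ s +
      ContinuousLinearMap.adjoint G (u₁ s))) s) :
    HasDerivAt (fun s => ⟪u₁ s, G (u₂ s)⟫_ℂ)
      (Complex.I * (-((κ₁ - κ₂ : ℝ) : ℂ) * ⟪u₁ s, G (u₂ s)⟫_ℂ
        + ((‖ContinuousLinearMap.adjoint G (u₁ s)‖ ^ 2 - ‖G (u₂ s)‖ ^ 2 : ℝ) : ℂ))) s := by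
  have h3 : HasDerivAt (fun s => G (u₂ s)) (G (Complex.I • ((κ₂ : ℂ) • u₂ s +
      ContinuousLinearMap.adjoint G (u₁ s)))) s :=
    (G.restrictScalars ℝ).hasFDerivAt.comp_hasDerivAt s h2
  convert! h1.inner ℂ h3 using 1
  have e1 : ⟪u₁ s, G (ContinuousLinearMap.adjoint G (u₁ s))⟫_ℂ
      = (‖ContinuousLinearMap.adjoint G (u₁ s)‖ : ℂ) ^ 2 := by
    rw [← ContinuousLinearMap.adjoint_inner_left]
    exact inner_self_eq_norm_sq_to_K _
  have e2 : ⟪G (u₂ s), G (u₂ s)⟫_ℂ = (‖G (u₂ s)‖ : ℂ) ^ 2 := inner_self_eq_norm_sq_to_K _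
  simp only [map_smul, map_add, inner_smul_right, inner_smul_left, inner_add_right,
    inner_add_left, e1, e2, Complex.conj_I, Complex.conj_ofReal]
  push_cast
  ring

lemma hasDerivAt_gauge {H : Type*} [NormedAddCommGroup H] [InnerProductSpace ℂ H] {u : ℝ → H} {w : H} {κ : ℝ → ℝ} {κ' s : ℝ}
    (h : HasDerivAt u (Complex.I • ((κ' : ℂ) • u s + w)) s) (hκ : HasDerivAt κ κ' s) :
    HasDerivAt (fun s => Complex.exp (-(Complex.I * κ s)) • u s)
      ((Complex.I * Complex.exp (-(Complex.I * κ s))) • w) s := by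
  have h1 := ((hκ.ofReal_comp.const_mul Complex.I).neg).cexp
  convert! h1.smul h using 1
  change _ = Complex.exp (-(Complex.I * κ s)) • _ + (Complex.exp (-(Complex.I * κ s)) * _) • _
  module

lemma norm_exp_I_mul_sub_le (x y : ℝ) :
    ‖Complex.exp (Complex.I * x) - Complex.exp (Complex.I * y)‖ ≤ |x - y| := by
  have h : Complex.exp (Complex.I * x) - Complex.exp (Complex.I * y)
      = Complex.exp (Complex.I * y) * (Complex.exp (Complex.I * (x - y : ℝ)) - 1) := by
    rw [mul_sub, ← Complex.exp_add]
    push_cast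
    ring_nf
  rw [h, norm_mul, Complex.norm_exp_I_mul_ofReal, one_mul]
  exact Real.norm_exp_I_mul_ofReal_sub_one_le

/-- From the asymptotics of the gauged amplitude `e^{-iκ}u` and of the phase `κ`, recover those
of `u`. -/
lemma ungauge_asymptotics {T : H →L[ℂ] H} (hT : IsSelfAdjoint T) {u : ℝ → H}
    {κ κ₀ τ : ℝ → ℝ} {c C₁ C₂ : ℝ} {β : H} (hu : ∀ s, ‖u s‖ ≤ 1)
    (ha : ∀ s, 1 ≤ s → ‖Complex.exp (-(Complex.I * κ s)) • u s - unitaryGroup T (τ s) β‖ ≤ C₁ / s)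
    (hκ : ∀ s, 1 ≤ s → |κ s - κ₀ s - c| ≤ C₂ / s) :
    ∃ ω : H, Tendsto (fun s => ‖u s‖) atTop (𝓝 ‖ω‖) ∧ ∀ s, 1 ≤ s →
      ‖u s - Complex.exp (Complex.I * κ₀ s) • unitaryGroup T (τ s) ω‖ ≤ (C₁ + C₂) / s := by
  have hn : ∀ s, ‖Complex.exp (-(Complex.I * κ s)) • u s‖ = ‖u s‖ := fun s => by
    rw [norm_smul, ← mul_neg, ← Complex.ofReal_neg, Complex.norm_exp_I_mul_ofReal, one_mul]
  have hlim : Tendsto (fun s => ‖u s‖) atTop (𝓝 ‖β‖) := by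
    rw [tendsto_iff_norm_sub_tendsto_zero]
    refine squeeze_zero' (Eventually.of_forall fun _ => norm_nonneg _)
      ((eventually_ge_atTop 1).mono fun s hs => ?_)
      (by simpa using tendsto_const_div_pow_atTop C₁ 1 one_ne_zero)
    refine le_trans ?_ (ha s hs)
    rw [← hn s, ← norm_unitaryGroup_apply hT (τ s) β]
    exact abs_norm_sub_norm_le _ _
  have hβ : ‖β‖ ≤ 1 := le_of_tendsto hlim (Eventually.of_forall hu)
  refine ⟨Complex.exp (Complex.I * c) • β, ?_, fun s hs => ?_⟩
  · rwa [norm_smul, Complex.norm_exp_I_mul_ofReal, one_mul]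
  have h1 : u s = Complex.exp (Complex.I * κ s) • Complex.exp (-(Complex.I * κ s)) • u s := by
    rw [smul_smul, ← Complex.exp_add, add_neg_cancel, Complex.exp_zero, one_smul]
  have h2 : u s - Complex.exp (Complex.I * κ₀ s) • unitaryGroup T (τ s)
        (Complex.exp (Complex.I * c) • β)
      = Complex.exp (Complex.I * κ s) •
          (Complex.exp (-(Complex.I * κ s)) • u s - unitaryGroup T (τ s) β)
        + (Complex.exp (Complex.I * κ s) - Complex.exp (Complex.I * (κ₀ s + c : ℝ))) •
          unitaryGroup T (τ s) β := by
    rw [smul_sub, ← h1, map_smul, smul_smul, ← Complex.exp_add, sub_smul, Complex.ofReal_add,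
      mul_add]
    abel
  rw [h2, add_div]
  refine (norm_add_le _ _).trans (add_le_add ?_ ?_)
  · rw [norm_smul, Complex.norm_exp_I_mul_ofReal, one_mul]
    exact ha s hs
  · rw [norm_smul, norm_unitaryGroup_apply hT]
    calc _ ≤ |κ s - (κ₀ s + c)| * 1 := by gcongr; exact norm_exp_I_mul_sub_le _ _
      _ = |κ s - κ₀ s - c| := by rw [mul_one, sub_add_eq_sub_sub]
      _ ≤ _ := hκ s hs

set_option maxHeartbeats 1600000 in
/-- Scattering for the system in which the nonlinearity depends on the population of the first
level only. -/
lemma exists_scattering_of_population (G : H →L[ℂ] H) {g₁ g₂ : ℝ → ℝ} (hg₁ : ContDiff ℝ 2 g₁)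
    (hg₂ : ContDiff ℝ 2 g₂) :
    ∃ C > 0, ∀ u₁ u₂ : ℝ → H,
      (∀ s : ℝ, HasDerivAt u₁
        (Complex.I • (((s + g₁ (‖u₁ s‖ ^ 2) : ℝ) : ℂ) • u₁ s + G (u₂ s))) s) →
      (∀ s : ℝ, HasDerivAt u₂ (Complex.I • (((-s + g₂ (‖u₁ s‖ ^ 2) : ℝ) : ℂ) • u₂ s +
        ContinuousLinearMap.adjoint G (u₁ s))) s) →
      (∀ s, ‖u₁ s‖ ^ 2 + ‖u₂ s‖ ^ 2 = 1) →
      ∃ ω₁ ω₂ : H, ‖ω₁‖ ^ 2 + ‖ω₂‖ ^ 2 = 1 ∧ ∀ s : ℝ, 1 ≤ s →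
        ‖u₁ s - Complex.exp (Complex.I * (g₁ (‖ω₁‖ ^ 2) * s + s ^ 2 / 2 : ℝ)) •
          unitaryGroup (G * ContinuousLinearMap.adjoint G) (Real.log s / 2) ω₁‖ ≤ C / s ∧
        ‖u₂ s - Complex.exp (Complex.I * (g₂ (‖ω₁‖ ^ 2) * s - s ^ 2 / 2 : ℝ)) •
          unitaryGroup (ContinuousLinearMap.adjoint G * G) (-(Real.log s / 2)) ω₂‖ ≤ C / s := by
  obtain ⟨K₁, hK₁, hb₁, ht₁⟩ := exists_taylor_bound hg₁
  obtain ⟨K₂, hK₂, hb₂, ht₂⟩ := exists_taylor_bound hg₂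
  set γ := ‖G‖ with hγ
  have hγ0 : 0 ≤ γ := norm_nonneg _
  set K₀ := K₁ + K₂ with hK₀
  have hK₀0 : 0 ≤ K₀ := by positivity
  set K := K₀ + γ + γ ^ 2 + 2 * K₀ * γ with hK
  have hK0 : 0 ≤ K := by positivity
  have hKK₁ : K₁ ≤ K := by rw [hK, hK₀]; nlinarith [mul_nonneg hK₀0 hγ0]
  have hKK₂ : K₂ ≤ K := by rw [hK, hK₀]; nlinarith [mul_nonneg hK₀0 hγ0]
  have hKK₀ : K₀ ≤ K := by rw [hK]; nlinarith [mul_nonneg hK₀0 hγ0]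
  have hKγ : γ ≤ K := by rw [hK]; nlinarith [mul_nonneg hK₀0 hγ0]
  have hKγ2 : γ ^ 2 ≤ K := by rw [hK]; nlinarith [mul_nonneg hK₀0 hγ0]
  have hKKγ : 2 * K₀ * γ ≤ K := by rw [hK]; nlinarith [mul_nonneg hK₀0 hγ0]
  set C₁ := (K ^ 2 + (1 / 2 + K / 2 + K)) * K + K / 2 * K ^ 2 + (1 / 2 + K / 2) / 2 * K ^ 3
    + (1 / 2 + K / 2) * K with hC₁
  set C₂ := 21 * K ^ 3 + 3 * K ^ 2 with hC₂
  refine ⟨C₁ + C₂ + 1, by positivity, fun u₁ u₂ hu₁ hu₂ hnorm => ?_⟩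
  set p : ℝ → ℝ := fun s => ‖u₁ s‖ ^ 2 with hp
  set m : ℝ → ℝ := fun x => (g₁ x - g₂ x) / 2 with hm
  have hp01 : ∀ s, p s ∈ Set.Icc (0 : ℝ) 1 := fun s =>
    ⟨by positivity, by simp only [hp]; nlinarith [hnorm s, sq_nonneg ‖u₂ s‖]⟩
  have hn₁ : ∀ s, ‖u₁ s‖ ≤ 1 := fun s => by
    rw [← sq_le_one_iff₀ (norm_nonneg _)]
    exact (hp01 s).2
  have hn₂ : ∀ s, ‖u₂ s‖ ≤ 1 := fun s => by
    rw [← sq_le_one_iff₀ (norm_nonneg _)]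
    nlinarith [hnorm s, sq_nonneg ‖u₁ s‖]
  have hGb : ∀ s, ‖G (u₂ s)‖ ≤ γ := fun s =>
    (G.le_opNorm _).trans (mul_le_of_le_one_right hγ0 (hn₂ s))
  have hG'b : ∀ s, ‖ContinuousLinearMap.adjoint G (u₁ s)‖ ≤ γ := fun s =>
    ((ContinuousLinearMap.adjoint G).le_opNorm _).trans (by
      rw [LinearIsometryEquiv.norm_map]
      exact mul_le_of_le_one_right hγ0 (hn₁ s))
  set z : ℝ → ℂ := fun s => ⟪u₁ s, G (u₂ s)⟫_ℂ with hz
  have hzb : ∀ s, ‖z s‖ ≤ γ := fun s =>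
    (norm_inner_le_norm _ _).trans ((mul_le_mul (hn₁ s) (hGb s) (norm_nonneg _) zero_le_one).trans
      (one_mul γ).le)
  set n : ℝ → ℝ := fun s => ‖ContinuousLinearMap.adjoint G (u₁ s)‖ ^ 2 - ‖G (u₂ s)‖ ^ 2 with hn
  have hzd : ∀ s, HasDerivAt z (Complex.I * (-((2 * (s + m (p s)) : ℝ) : ℂ) * z s + (n s : ℂ))) s :=
    fun s => by
      convert! hasDerivAt_inner_of_ode (hu₁ s) (hu₂ s) using 5
      simp only [hm, hp]
      push_cast
      ring
  have hpd : ∀ s, HasDerivAt p (-2 * (z s).im) s := fun s => hasDerivAt_norm_sq_of_ode (hu₁ s)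
  have hrd : ∀ s, HasDerivAt (fun s => (z s).re) (2 * (s + m (p s)) * (z s).im) s := fun s => by
    convert! Complex.reCLM.hasFDerivAt.comp_hasDerivAt s (hzd s) using 1
    simp
  have hqd : ∀ s, HasDerivAt (fun s => (z s).im) (-2 * (s + m (p s)) * (z s).re + n s) s :=
    fun s => by
      convert! Complex.imCLM.hasFDerivAt.comp_hasDerivAt s (hzd s) using 1
      simp
  have hnb : ∀ s, |n s| ≤ K := fun s => by
    have h1 := pow_le_pow_left₀ (norm_nonneg _) (hGb s) 2
    have h2 := pow_le_pow_left₀ (norm_nonneg _) (hG'b s) 2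
    rw [abs_le]
    constructor <;> simp only [hn] <;>
      nlinarith [sq_nonneg ‖G (u₂ s)‖, sq_nonneg ‖ContinuousLinearMap.adjoint G (u₁ s)‖]
  have hmb : ∀ x ∈ Set.Icc (0 : ℝ) 1, |m x| ≤ K₀ := fun x hx => by
    have h1 := abs_le.1 (hb₁ x hx).1
    have h2 := abs_le.1 (hb₂ x hx).1
    rw [abs_le]
    constructor <;> simp only [hm] <;> linarith
  have hmc : Continuous m := (hg₁.continuous.sub hg₂.continuous).div_const 2
  set Mi : ℝ → ℝ := fun x => ∫ t in (0 : ℝ)..x, m t with hMi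
  have hMid : ∀ x, HasDerivAt Mi (m x) x := fun x => (hmc.integral_hasStrictDerivAt 0 x).hasDerivAt
  have hMil : ∀ x ∈ Set.Icc (0 : ℝ) 1, ∀ y ∈ Set.Icc (0 : ℝ) 1, |Mi x - Mi y| ≤ K₀ * |x - y| :=
    fun x hx y hy => (convex_Icc (0 : ℝ) 1).norm_image_sub_le_of_norm_hasDerivWithin_le
      (fun w _ => (hMid w).hasDerivWithinAt) hmb hy hx
  have hMib : ∀ x ∈ Set.Icc (0 : ℝ) 1, |Mi x| ≤ K₀ := fun x hx => by
    have h1 := hMil x hx 0 (by simp)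
    have h2 : Mi 0 = 0 := intervalIntegral.integral_same
    rw [h2, sub_zero, sub_zero, abs_of_nonneg hx.1] at h1
    nlinarith [hx.2]
  obtain ⟨pinf, hpinf, c, Q, hQ, hpt, hpb, hQb⟩ := population_asymptotics hMid
    (fun x hx => (hmb x hx).trans hKK₀) (fun x hx => (hMib x hx).trans hKK₀)
    (fun x hx y hy => (hMil x hx y hy).trans (by gcongr)) hp01
    (fun s => ((Complex.abs_re_le_norm _).trans (hzb s)).trans hKγ)
    (fun s => ((Complex.abs_im_le_norm _).trans (hzb s)).trans hKγ) hnb hpd hrd hqd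
  have hpc : Continuous p := continuous_iff_continuousAt.2 fun s => (hpd s).continuousAt
  have hΦ : ∀ g : ℝ → ℝ, Continuous g → ∀ s,
      HasDerivAt (fun s => ∫ t in (1 : ℝ)..s, g (p t)) (g (p s)) s := fun g hg s =>
    ((hg.comp hpc).integral_hasStrictDerivAt 1 s).hasDerivAt
  set Φ₁ : ℝ → ℝ := fun s => ∫ t in (1 : ℝ)..s, g₁ (p t) with hΦ₁
  set Φ₂ : ℝ → ℝ := fun s => ∫ t in (1 : ℝ)..s, g₂ (p t) with hΦ₂
  obtain ⟨c₁, hc₁⟩ := phase_asymptotics ((hb₁ _ hpinf).2.trans hKK₁)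
    (fun x hx => (ht₁ x hx _ hpinf).trans (by gcongr)) hp01 hQ hpb hQb (hΦ g₁ hg₁.continuous)
  obtain ⟨c₂, hc₂⟩ := phase_asymptotics ((hb₂ _ hpinf).2.trans hKK₂)
    (fun x hx => (ht₂ x hx _ hpinf).trans (by gcongr)) hp01 hQ hpb hQb (hΦ g₂ hg₂.continuous)
  set κ₁ : ℝ → ℝ := fun s => s ^ 2 / 2 + Φ₁ s with hκ₁
  set κ₂ : ℝ → ℝ := fun s => -(s ^ 2 / 2) + Φ₂ s with hκ₂
  have hsq : ∀ s : ℝ, HasDerivAt (fun s : ℝ => s ^ 2 / 2) s s := fun s => by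
    convert! (hasDerivAt_pow 2 s).div_const 2 using 1
    simp
  have hκ₁d : ∀ s, HasDerivAt κ₁ (s + g₁ (p s)) s := fun s => (hsq s).add (hΦ g₁ hg₁.continuous s)
  have hκ₂d : ∀ s, HasDerivAt κ₂ (-s + g₂ (p s)) s := fun s =>
    (hsq s).neg.add (hΦ g₂ hg₂.continuous s)
  set ψ : ℝ → ℝ := fun s => κ₁ s - κ₂ s with hψ
  have hψd : ∀ s, HasDerivAt ψ (2 * 1 * (s + m (p s))) s := fun s => by
    convert! (hκ₁d s).sub (hκ₂d s) using 1
    simp only [hm]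
    ring
  set a : ℝ → H := fun s => Complex.exp (-(Complex.I * κ₁ s)) • u₁ s with ha
  set b : ℝ → H := fun s => Complex.exp (-(Complex.I * κ₂ s)) • u₂ s with hb
  have hab : ∀ s, ‖a s‖ ≤ 1 := fun s => by
    simp only [ha]
    rw [norm_smul, ← mul_neg, ← Complex.ofReal_neg, Complex.norm_exp_I_mul_ofReal, one_mul]
    exact hn₁ s
  have hbb : ∀ s, ‖b s‖ ≤ 1 := fun s => by
    simp only [hb]
    rw [norm_smul, ← mul_neg, ← Complex.ofReal_neg, Complex.norm_exp_I_mul_ofReal, one_mul]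
    exact hn₂ s
  have had : ∀ s, HasDerivAt a ((Complex.I * Complex.exp (-(Complex.I * ψ s))) • G (b s)) s :=
    fun s => by
      convert! hasDerivAt_gauge (hu₁ s) (hκ₁d s) using 1
      simp only [hb, map_smul, smul_smul]
      rw [mul_assoc, ← Complex.exp_add]
      congr 3
      simp only [hψ]
      push_cast
      ring
  have hbd : ∀ s, HasDerivAt b ((Complex.I * Complex.exp (Complex.I * ψ s)) •
      ContinuousLinearMap.adjoint G (a s)) s :=
    fun s => by
      convert! hasDerivAt_gauge (hu₂ s) (hκ₂d s) using 1
      simp only [ha, map_smul, smul_smul]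
      rw [mul_assoc, ← Complex.exp_add]
      congr 3
      simp only [hψ]
      push_cast
      ring
  set m' : ℝ → ℝ := fun s => (deriv g₁ (p s) - deriv g₂ (p s)) / 2 * (-2 * (z s).im) with hm'
  have hmd : ∀ s, HasDerivAt (fun s => m (p s)) (m' s) s := fun s =>
    (((hg₁.differentiable two_ne_zero (p s)).hasDerivAt.sub
      (hg₂.differentiable two_ne_zero (p s)).hasDerivAt).div_const 2).comp s (hpd s)
  have hm'b : ∀ s, |m' s| ≤ K := fun s => by
    have h1 := abs_le.1 (hb₁ _ (hp01 s)).2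
    have h2 := abs_le.1 (hb₂ _ (hp01 s)).2
    have h3 : |(deriv g₁ (p s) - deriv g₂ (p s)) / 2| ≤ K₀ := by
      rw [abs_le]
      constructor <;> linarith
    have h4 : |-2 * (z s).im| ≤ 2 * γ := by
      rw [abs_mul, abs_neg, abs_two]
      gcongr
      exact (Complex.abs_im_le_norm _).trans (hzb s)
    calc |m' s| = _ := abs_mul _ _
      _ ≤ K₀ * (2 * γ) := mul_le_mul h3 h4 (abs_nonneg _) hK₀0
      _ ≤ K := by linarith
  have hmbs : ∀ s, |m (p s)| ≤ K := fun s => (hmb _ (hp01 s)).trans hKK₀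
  obtain ⟨β₁, hβ₁⟩ := amplitude_asymptotics (ε := 1) (K := K) (by simp) hKγ hmbs hm'b hmd hψd
    hab hbb had hbd
  obtain ⟨β₂, hβ₂⟩ := amplitude_asymptotics (L := ContinuousLinearMap.adjoint G) (ε := -1)
    (K := K) (ψ := fun s => -ψ s) (a := b) (b := a) (by simp)
    (by rwa [LinearIsometryEquiv.norm_map]) hmbs hm'b hmd
    (fun s => by convert! (hψd s).neg using 1; ring) hbb hab
    (fun s => by simpa using hbd s) (fun s => by simpa using had s)
  rw [ContinuousLinearMap.adjoint_adjoint] at hβ₂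
  obtain ⟨ω₁, hω₁, he₁⟩ := ungauge_asymptotics (isSelfAdjoint_mul_adjoint G) (u := u₁) (κ := κ₁)
    (κ₀ := fun s => g₁ pinf * s + s ^ 2 / 2) (τ := fun s => Real.log s / 2) (c := c₁) hn₁
    (fun s hs => by simpa only [one_mul] using hβ₁ s hs)
    (fun s hs => by
      convert hc₁ s hs using 2
      simp only [hκ₁]
      ring)
  obtain ⟨ω₂, hω₂, he₂⟩ := ungauge_asymptotics (isSelfAdjoint_adjoint_mul G) (u := u₂) (κ := κ₂)
    (κ₀ := fun s => g₂ pinf * s - s ^ 2 / 2) (τ := fun s => -(Real.log s / 2)) (c := c₂) hn₂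
    (fun s hs => by simpa only [neg_mul, one_mul] using hβ₂ s hs)
    (fun s hs => by
      convert hc₂ s hs using 2
      simp only [hκ₂]
      ring)
  have hω₁p : ‖ω₁‖ ^ 2 = pinf := tendsto_nhds_unique (hω₁.pow 2) hpt
  have hω : ‖ω₁‖ ^ 2 + ‖ω₂‖ ^ 2 = 1 := by
    have h := (hω₁.pow 2).add (hω₂.pow 2)
    simp only [hnorm] at h
    exact tendsto_nhds_unique h tendsto_const_nhds
  refine ⟨ω₁, ω₂, hω, fun s hs => ?_⟩
  rw [hω₁p]
  have hle : (C₁ + C₂) / s ≤ (C₁ + C₂ + 1) / s :=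
    div_le_div_of_nonneg_right (by linarith) (by positivity)
  exact ⟨(he₁ s hs).trans hle, (he₂ s hs).trans hle⟩

lemma ePhaseP_apply (G : H →L[ℂ] H) (s : ℝ) (x : H) :
    ePhaseP G s x = Complex.exp (Complex.I * (s ^ 2 / 2 : ℝ)) •
      unitaryGroup (G * ContinuousLinearMap.adjoint G) (Real.log |s| / 2) x := by
  rw [ePhaseP_eq]
  rfl

lemma ePhaseM_apply (G : H →L[ℂ] H) (s : ℝ) (x : H) :
    ePhaseM G s x = Complex.exp (Complex.I * (-(s ^ 2 / 2) : ℝ)) •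
      unitaryGroup (ContinuousLinearMap.adjoint G * G) (-(Real.log |s| / 2)) x := by
  rw [ePhaseM_eq]
  rfl

lemma asym1_eq (G : H →L[ℂ] H) (δ : ℝ) (f : ℝ × ℝ → ℝ) (ω : WithLp 2 (H × H)) (s : ℝ) :
    asym1 G δ f ω 0 s = Complex.exp (Complex.I * (δ * F1 f ω * s + s ^ 2 / 2 : ℝ)) •
      unitaryGroup (G * ContinuousLinearMap.adjoint G) (Real.log |s| / 2) ω.fst := by
  rw [asym1, ePhaseP_apply, smul_smul, ← Complex.exp_add]
  congr 2
  push_cast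
  ring

lemma asym2_eq (G : H →L[ℂ] H) (δ : ℝ) (f : ℝ × ℝ → ℝ) (ω : WithLp 2 (H × H)) (s : ℝ) :
    asym2 G δ f ω 0 s = Complex.exp (Complex.I * (δ * F2 f ω * s - s ^ 2 / 2 : ℝ)) •
      unitaryGroup (ContinuousLinearMap.adjoint G * G) (-(Real.log |s| / 2)) ω.snd := by
  rw [asym2, ePhaseM_apply, smul_smul, ← Complex.exp_add]
  congr 2
  push_cast
  ring

lemma norm_asym1 (G : H →L[ℂ] H) (δ : ℝ) (f : ℝ × ℝ → ℝ) (ω : WithLp 2 (H × H)) (s : ℝ) :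
    ‖asym1 G δ f ω 0 s‖ = ‖ω.fst‖ := by
  rw [asym1_eq, norm_smul, Complex.norm_exp_I_mul_ofReal, one_mul,
    norm_unitaryGroup_apply (isSelfAdjoint_mul_adjoint G)]

lemma norm_asym2 (G : H →L[ℂ] H) (δ : ℝ) (f : ℝ × ℝ → ℝ) (ω : WithLp 2 (H × H)) (s : ℝ) :
    ‖asym2 G δ f ω 0 s‖ = ‖ω.snd‖ := by
  rw [asym2_eq, norm_smul, Complex.norm_exp_I_mul_ofReal, one_mul,
    norm_unitaryGroup_apply (isSelfAdjoint_adjoint_mul G)]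

lemma norm_asym1_sub (G : H →L[ℂ] H) (δ : ℝ) (f : ℝ × ℝ → ℝ) {ω ω' : WithLp 2 (H × H)}
    (h : F1 f ω = F1 f ω') (s : ℝ) :
    ‖asym1 G δ f ω 0 s - asym1 G δ f ω' 0 s‖ = ‖ω.fst - ω'.fst‖ := by
  rw [asym1_eq, asym1_eq, h, ← smul_sub, ← map_sub, norm_smul, Complex.norm_exp_I_mul_ofReal,
    one_mul, norm_unitaryGroup_apply (isSelfAdjoint_mul_adjoint G)]

lemma norm_asym2_sub (G : H →L[ℂ] H) (δ : ℝ) (f : ℝ × ℝ → ℝ) {ω ω' : WithLp 2 (H × H)}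
    (h : F2 f ω = F2 f ω') (s : ℝ) :
    ‖asym2 G δ f ω 0 s - asym2 G δ f ω' 0 s‖ = ‖ω.snd - ω'.snd‖ := by
  rw [asym2_eq, asym2_eq, h, ← smul_sub, ← map_sub, norm_smul, Complex.norm_exp_I_mul_ofReal,
    one_mul, norm_unitaryGroup_apply (isSelfAdjoint_adjoint_mul G)]

lemma eq_of_tendsto_sub_of_norm_sub_eq {E : Type*} [NormedAddCommGroup E]
    {x y y' : ℝ → E} {r : ℝ}
    (h : Tendsto (fun s => ‖x s - y s‖) atTop (𝓝 0))
    (h' : Tendsto (fun s => ‖x s - y' s‖) atTop (𝓝 0)) (hr : ∀ s, ‖y s - y' s‖ = r) : r = 0 := by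
  have h0 : Tendsto (fun _ : ℝ => r) atTop (𝓝 0) := by
    refine squeeze_zero (fun s => hr s ▸ norm_nonneg _) (fun s => ?_) (by simpa using h.add h')
    rw [← hr s, ← norm_sub_rev (y s) (x s)]
    exact norm_sub_le_norm_sub_add_norm_sub _ _ _
  exact tendsto_nhds_unique tendsto_const_nhds h0

lemma norm_eq_of_tendsto_sub {E : Type*} [NormedAddCommGroup E]
    {x y y' : ℝ → E} {r r' : ℝ}
    (h : Tendsto (fun s => ‖x s - y s‖) atTop (𝓝 0))
    (h' : Tendsto (fun s => ‖x s - y' s‖) atTop (𝓝 0)) (hr : ∀ s, ‖y s‖ = r)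
    (hr' : ∀ s, ‖y' s‖ = r') : r = r' := by
  have key : ∀ (z : ℝ → E) (ρ : ℝ), Tendsto (fun s => ‖x s - z s‖) atTop (𝓝 0) →
      (∀ s, ‖z s‖ = ρ) → Tendsto (fun s => ‖x s‖) atTop (𝓝 ρ) := by
    intro z ρ hz hρ
    rw [tendsto_iff_norm_sub_tendsto_zero]
    exact squeeze_zero (fun _ => norm_nonneg _)
      (fun s => hρ s ▸ abs_norm_sub_norm_le (x s) (z s)) hz
  exact tendsto_nhds_unique (key y r h hr) (key y' r' h' hr')

lemma Outgoing.unique {G : H →L[ℂ] H} {δ : ℝ} {f₁ f₂ : ℝ × ℝ → ℝ} {ω ω' : WithLp 2 (H × H)}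
    {u : ℝ → WithLp 2 (H × H)} (h : Outgoing G δ f₁ f₂ ω 0 u) (h' : Outgoing G δ f₁ f₂ ω' 0 u) :
    ω = ω' := by
  have fst_part : ∀ η, Outgoing G δ f₁ f₂ η 0 u →
      Tendsto (fun s => ‖(u s).fst - asym1 G δ f₁ η 0 s‖) atTop (𝓝 0) := fun η hη =>
    squeeze_zero (fun _ => norm_nonneg _) (fun _ => le_add_of_nonneg_right (norm_nonneg _)) hη
  have snd_part : ∀ η, Outgoing G δ f₁ f₂ η 0 u →
      Tendsto (fun s => ‖(u s).snd - asym2 G δ f₂ η 0 s‖) atTop (𝓝 0) := fun η hη =>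
    squeeze_zero (fun _ => norm_nonneg _) (fun _ => le_add_of_nonneg_left (norm_nonneg _)) hη
  have e1 : ‖ω.fst‖ = ‖ω'.fst‖ := norm_eq_of_tendsto_sub (fst_part ω h) (fst_part ω' h')
    (norm_asym1 G δ f₁ ω) (norm_asym1 G δ f₁ ω')
  have e2 : ‖ω.snd‖ = ‖ω'.snd‖ := norm_eq_of_tendsto_sub (snd_part ω h) (snd_part ω' h')
    (norm_asym2 G δ f₂ ω) (norm_asym2 G δ f₂ ω')
  have d1 := eq_of_tendsto_sub_of_norm_sub_eq (fst_part ω h) (fst_part ω' h')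
    (norm_asym1_sub G δ f₁ (by simp only [F1, e1, e2]))
  have d2 := eq_of_tendsto_sub_of_norm_sub_eq (snd_part ω h) (snd_part ω' h')
    (norm_asym2_sub G δ f₂ (by simp only [F2, e1, e2]))
  exact WithLp.ofLp_injective 2
    (Prod.ext (sub_eq_zero.1 (norm_eq_zero.1 d1)) (sub_eq_zero.1 (norm_eq_zero.1 d2)))

lemma outgoing_of_le {G : H →L[ℂ] H} {δ C : ℝ} {f₁ f₂ : ℝ × ℝ → ℝ} {ω : WithLp 2 (H × H)}
    {u : ℝ → WithLp 2 (H × H)}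
    (h : ∀ s : ℝ, 1 ≤ s → ‖(u s).fst - asym1 G δ f₁ ω 0 s‖ ≤ C / s ∧
      ‖(u s).snd - asym2 G δ f₂ ω 0 s‖ ≤ C / s) : Outgoing G δ f₁ f₂ ω 0 u := by
  have h0 : Tendsto (fun s : ℝ => C / s) atTop (𝓝 0) := by
    simpa using tendsto_const_div_pow_atTop C 1 one_ne_zero
  refine squeeze_zero' (Eventually.of_forall fun _ => by positivity)
    ((eventually_ge_atTop 1).mono fun s hs => add_le_add (h s hs).1 (h s hs).2)
    (by simpa using h0.add h0)

lemma IsLZSol.hasDerivAt_fst {G : H →L[ℂ] H} {δ : ℝ} {f₁ f₂ : ℝ × ℝ → ℝ}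
    {u : ℝ → WithLp 2 (H × H)} (hu : IsLZSol G δ f₁ f₂ u) (s : ℝ) :
    HasDerivAt (fun s => (u s).fst)
      (Complex.I • (((s + δ * F1 f₁ (u s) : ℝ) : ℂ) • (u s).fst + G (u s).snd)) s := by
  have h := (((ContinuousLinearMap.fst ℂ H H ∘L
    (eqv (H := H)).toContinuousLinearMap).restrictScalars ℝ).hasFDerivAt).comp_hasDerivAt s (hu s)
  have e : Complex.I • (((s + δ * F1 f₁ (u s) : ℝ) : ℂ) • (u s).fst + G (u s).snd)
      = Complex.I • (((s : ℂ) • (u s).fst + G (u s).snd) + δ • F1 f₁ (u s) • (u s).fst) := by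
    simp only [Complex.coe_smul]
    module
  rw [e]
  exact h

lemma IsLZSol.hasDerivAt_snd {G : H →L[ℂ] H} {δ : ℝ} {f₁ f₂ : ℝ × ℝ → ℝ}
    {u : ℝ → WithLp 2 (H × H)} (hu : IsLZSol G δ f₁ f₂ u) (s : ℝ) :
    HasDerivAt (fun s => (u s).snd) (Complex.I • (((-s + δ * F2 f₂ (u s) : ℝ) : ℂ) • (u s).snd +
      ContinuousLinearMap.adjoint G (u s).fst)) s := by
  have h := (((ContinuousLinearMap.snd ℂ H H ∘L
    (eqv (H := H)).toContinuousLinearMap).restrictScalars ℝ).hasFDerivAt).comp_hasDerivAt s (hu s)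
  have e : Complex.I • (((-s + δ * F2 f₂ (u s) : ℝ) : ℂ) • (u s).snd +
        ContinuousLinearMap.adjoint G (u s).fst)
      = Complex.I • ((ContinuousLinearMap.adjoint G (u s).fst - (s : ℂ) • (u s).snd) +
        δ • F2 f₂ (u s) • (u s).snd) := by
    simp only [Complex.coe_smul]
    module
  rw [e]
  exact h

lemma IsLZSol.norm_sq_add_norm_sq {G : H →L[ℂ] H} {δ : ℝ} {f₁ f₂ : ℝ × ℝ → ℝ}
    {u : ℝ → WithLp 2 (H × H)} (hu : IsLZSol G δ f₁ f₂ u) (s : ℝ) :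
    ‖(u s).fst‖ ^ 2 + ‖(u s).snd‖ ^ 2 = ‖(u 0).fst‖ ^ 2 + ‖(u 0).snd‖ ^ 2 := by
  have hd : ∀ s, HasDerivAt (fun s => ‖(u s).fst‖ ^ 2 + ‖(u s).snd‖ ^ 2) 0 s := fun s => by
    have h := (hasDerivAt_norm_sq_of_ode (u := fun s => (u s).fst) (hu.hasDerivAt_fst s)).add
      (hasDerivAt_norm_sq_of_ode (u := fun s => (u s).snd) (hu.hasDerivAt_snd s))
    refine h.congr_deriv ?_
    rw [ContinuousLinearMap.adjoint_inner_right, ← inner_conj_symm, Complex.conj_im]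
    ring
  exact is_const_of_deriv_eq_zero (fun s => (hd s).differentiableAt) (fun s => (hd s).deriv) s 0

lemma IsLZSol.exists_outgoing (G : H →L[ℂ] H) (δ : ℝ) {f₁ f₂ : ℝ × ℝ → ℝ}
    (hf₁ : ContDiff ℝ 2 f₁) (hf₂ : ContDiff ℝ 2 f₂) :
    ∃ C > 0, ∀ u, IsLZSol G δ f₁ f₂ u → ‖(u 0).fst‖ ^ 2 + ‖(u 0).snd‖ ^ 2 = 1 →
      ∃ ω : WithLp 2 (H × H), ∀ s : ℝ, 1 ≤ s →
        ‖(u s).fst - asym1 G δ f₁ ω 0 s‖ ≤ C / s ∧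
        ‖(u s).snd - asym2 G δ f₂ ω 0 s‖ ≤ C / s := by
  have hg : ∀ {f : ℝ × ℝ → ℝ}, ContDiff ℝ 2 f → ContDiff ℝ 2 fun x => δ * f (x, 1 - x) :=
    fun hf => contDiff_const.mul (hf.comp (contDiff_id.prodMk (contDiff_const.sub contDiff_id)))
  obtain ⟨C, hC, h⟩ := exists_scattering_of_population G (hg hf₁) (hg hf₂)
  refine ⟨C, hC, fun u hu h0 => ?_⟩
  have hn : ∀ s, ‖(u s).fst‖ ^ 2 + ‖(u s).snd‖ ^ 2 = 1 := fun s =>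
    (hu.norm_sq_add_norm_sq s).trans h0
  have hs2 : ∀ s, 1 - ‖(u s).fst‖ ^ 2 = ‖(u s).snd‖ ^ 2 := fun s => by rw [← hn s]; ring
  obtain ⟨ω₁, ω₂, hω, hest⟩ := h (fun s => (u s).fst) (fun s => (u s).snd)
    (fun s => by simpa only [hs2, F1, F2] using hu.hasDerivAt_fst s)
    (fun s => by simpa only [hs2, F1, F2] using hu.hasDerivAt_snd s) hn
  refine ⟨WithLp.toLp 2 (ω₁, ω₂), fun s hs => ?_⟩
  have hω2 : 1 - ‖ω₁‖ ^ 2 = ‖ω₂‖ ^ 2 := by rw [← hω]; ring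
  rw [asym1_eq, asym2_eq, abs_of_nonneg (zero_le_one.trans hs)]
  have := hest s hs
  rw [hω2] at this
  exact this

lemma IsLZSol.comp_neg {G : H →L[ℂ] H} {δ : ℝ} {f₁ f₂ : ℝ × ℝ → ℝ} {u : ℝ → WithLp 2 (H × H)}
    (hu : IsLZSol G δ f₁ f₂ u) : IsLZSol (-G) (-δ) f₁ f₂ (fun s => u (-s)) := by
  intro s
  have h := (hu (-s)).scomp s (hasDerivAt_neg s)
  refine h.congr_deriv ?_
  have hV : Vop (-G) s = -Vop G (-s) := by
    ext1 w
    refine WithLp.ofLp_injective 2 (Prod.ext ?_ ?_)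
    · change (s : ℂ) • w.fst + (-G) w.snd = -(((-s : ℝ) : ℂ) • w.fst + G w.snd)
      simp [add_comm]
    · change ContinuousLinearMap.adjoint (-G) w.fst - (s : ℂ) • w.snd
        = -(ContinuousLinearMap.adjoint G w.fst - ((-s : ℝ) : ℂ) • w.snd)
      simp [sub_eq_add_neg, add_comm]
  rw [hV, neg_apply]
  module

lemma asym1_neg (G : H →L[ℂ] H) (δ : ℝ) (f : ℝ × ℝ → ℝ) (ω : WithLp 2 (H × H)) (s : ℝ) :
    asym1 (-G) (-δ) f ω 0 (-s) = asym1 G δ f ω 0 s := by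
  simp only [asym1_eq, map_neg, neg_mul, mul_neg, neg_neg, abs_neg, neg_sq]

lemma asym2_neg (G : H →L[ℂ] H) (δ : ℝ) (f : ℝ × ℝ → ℝ) (ω : WithLp 2 (H × H)) (s : ℝ) :
    asym2 (-G) (-δ) f ω 0 (-s) = asym2 G δ f ω 0 s := by
  simp only [asym2_eq, map_neg, neg_mul, mul_neg, neg_neg, abs_neg, neg_sq]

lemma Incoming.outgoing_comp_neg {G : H →L[ℂ] H} {δ : ℝ} {f₁ f₂ : ℝ × ℝ → ℝ}
    {α : WithLp 2 (H × H)} {u : ℝ → WithLp 2 (H × H)} (h : Incoming G δ f₁ f₂ α 0 u) :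
    Outgoing (-G) (-δ) f₁ f₂ α 0 (fun s => u (-s)) := by
  refine (h.comp tendsto_neg_atTop_atBot).congr fun s => ?_
  simp only [Function.comp, ← asym1_neg G, ← asym2_neg G, neg_neg]

/-- existence and uniqueness of scattering states (Theorem 1.5). -/
theorem stmt_2 {K : Type*} [NormedAddCommGroup K] [InnerProductSpace ℂ K]
    [FiniteDimensional ℂ K]
    (G : K →L[ℂ] K) (hG : CommHyp G) (δ : ℝ) (f₁ f₂ : ℝ × ℝ → ℝ)
    (hf₁ : C2Bdd f₁) (hf₂ : C2Bdd f₂) (θ : ℝ → ℝ) (hθ : IsCutoff θ)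
    (R : ℝ) (hR : 0 < R) :
    ∃ C > 0, ∀ u₀ : WithLp 2 (K × K), ∀ u : ℝ → WithLp 2 (K × K),
      Theta G θ R u₀ = u₀ → ‖u₀.fst‖ ^ 2 + ‖u₀.snd‖ ^ 2 = 1 →
      IsLZSol G δ f₁ f₂ u → u 0 = u₀ →
      ∃ ω α : WithLp 2 (K × K),
        (∀ s : ℝ, 1 ≤ s →
          ‖(u s).fst - asym1 G δ f₁ ω 0 s‖ ≤ C / s ∧
          ‖(u s).snd - asym2 G δ f₂ ω 0 s‖ ≤ C / s) ∧
        (∀ s : ℝ, s ≤ -1 →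
          ‖(u s).fst - asym1 G δ f₁ α 0 s‖ ≤ C / |s| ∧
          ‖(u s).snd - asym2 G δ f₂ α 0 s‖ ≤ C / |s|) ∧
        (∀ ω' : WithLp 2 (K × K), Outgoing G δ f₁ f₂ ω' 0 u → ω' = ω) ∧
        (∀ α' : WithLp 2 (K × K), Incoming G δ f₁ f₂ α' 0 u → α' = α) := by
  have := FiniteDimensional.complete ℂ K
  obtain ⟨C₁, hC₁, h₁⟩ := IsLZSol.exists_outgoing G δ hf₁.1 hf₂.1
  obtain ⟨C₂, hC₂, h₂⟩ := IsLZSol.exists_outgoing (-G) (-δ) hf₁.1 hf₂.1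
  refine ⟨C₁ + C₂, by positivity, fun u₀ u _ hu₀ hu h0 => ?_⟩
  obtain ⟨ω, hω⟩ := h₁ u hu (by rw [h0, hu₀])
  obtain ⟨α, hα⟩ := h₂ _ hu.comp_neg (by rw [neg_zero, h0, hu₀])
  refine ⟨ω, α, fun s hs => ?_, fun s hs => ?_, fun ω' h => h.unique (outgoing_of_le hω),
    fun α' h => h.outgoing_comp_neg.unique (outgoing_of_le hα)⟩
  · have hle : C₁ / s ≤ (C₁ + C₂) / s := by gcongr; linarith
    exact ⟨(hω s hs).1.trans hle, (hω s hs).2.trans hle⟩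
  · have hle : C₂ / -s ≤ (C₁ + C₂) / -s :=
      div_le_div_of_nonneg_right (by linarith) (by linarith)
    have h := hα (-s) (by linarith)
    rw [asym1_neg, asym2_neg, neg_neg] at h
    rw [abs_of_neg (by linarith)]
    exact ⟨h.1.trans hle, h.2.trans hle⟩

end
end
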